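/- Let M be an endotrivial V(a_r)-supermodule, where a_r is a rank r detecting subalgebra with odd basis {a_1,…,a_r}. Let v = c_1 a_1 + ⋯ + c_r a_r ∈ (a_r)_1 with c_i ≠ 0 for some i < r, and let A = ⟨v, a_r⟩ be the 4-dimensional subsuperalgebra of V(a_r) generated by v and a_r. Then there exists an integer s, independent of the choice of v, such that M|_A ≅ Ω^s(k|_A) ⊕ P for some projective A-module P, where k|_A is either k_ev or k_od; moreover the parity of k|_A is also independent of the choice of v. -/

import Mathlib

/-!
A concrete model of the supermodule categories of the paper "On Endotrivial
Modules for Lie Superalgebras" attached to the detecting subalgebras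
`e_r = q(1)^{×r}`, `f_n = sl(1|1)^{×n}`, to rank-one subalgebras `⟨z⟩` of
`sl(1|1)`, and to the exterior superalgebras `V(a_r) = Λ((a_r)₁)`.

A `GSupMod k ι` is a finite-dimensional `ℤ₂`-graded `k`-vector space together
with a family of odd operators `θ i` (the actions of the distinguished odd
basis elements of the superalgebra: the `e_i` for `e_r`, the `x_i, y_i` for
`f_n`, the `a_i` for `V(a_r)`).  The even parts of all these superalgebras are
generated by the brackets of the odd generators, so the relations defining
each particular category, as well as complete reducibility over the even part,
are imposed by a predicate `𝒞 : GSupMod k ι → Prop`, defined separately for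
each case.  All categorical notions (homomorphisms, isomorphisms, direct sums,
tensor products, duals, internal Hom, trivial modules, projectivity,
projective covers and injective hulls, syzygies `Ωⁿ` for `n : ℤ`, endotrivial
modules, and the group `T` of stable classes of endotrivial modules) are
defined relative to such a predicate.
-/

noncomputable section

namespace SupCat

open Submodule

/-- A finite-dimensional `ℤ₂`-graded `k`-vector space with a family of odd
operators `θ i`, indexed by `ι` (the underlying data of a supermodule over a
superalgebra whose odd part has a distinguished basis indexed by `ι`). -/
structure GSupMod (k : Type) [Field k] (ι : Type) : Type 1 where
  carrier : Type
  [isAddCommGroup : AddCommGroup carrier]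
  [isModule : Module k carrier]
  [isFinite : FiniteDimensional k carrier]
  /-- the even component -/
  ev : Submodule k carrier
  /-- the odd component -/
  od : Submodule k carrier
  isCompl : IsCompl ev od
  /-- the (odd) actions of the distinguished odd basis elements -/
  θ : ι → (carrier →ₗ[k] carrier)
  θ_ev : ∀ i, ∀ m ∈ ev, θ i m ∈ od
  θ_od : ∀ i, ∀ m ∈ od, θ i m ∈ ev

attribute [instance] GSupMod.isAddCommGroup GSupMod.isModule GSupMod.isFinite

namespace GSupMod

variable {k : Type} [Field k] {ι : Type}

/-- The action of a general odd element `v = ∑ v i • (basis element i)`. -/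
def actOf [Fintype ι] (M : GSupMod k ι) (v : ι → k) : M.carrier →ₗ[k] M.carrier :=
  ∑ i, v i • M.θ i

/-- The grading involution `σ` of a supermodule: `+1` on the even part and
`-1` on the odd part. -/
def sigma (M : GSupMod k ι) : M.carrier →ₗ[k] M.carrier :=
  M.ev.subtype ∘ₗ Submodule.linearProjOfIsCompl M.ev M.od M.isCompl
    - M.od.subtype ∘ₗ Submodule.linearProjOfIsCompl M.od M.ev M.isCompl.symm

/-- `f` is a homomorphism of supermodules (an equivariant linear map of
degree `0̄`). -/
def IsHom (M N : GSupMod k ι) (f : M.carrier →ₗ[k] N.carrier) : Prop :=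
  (∀ i, f ∘ₗ M.θ i = N.θ i ∘ₗ f) ∧
  (∀ m ∈ M.ev, f m ∈ N.ev) ∧ (∀ m ∈ M.od, f m ∈ N.od)

/-- `M ≅ N` as supermodules. -/
def Iso (M N : GSupMod k ι) : Prop :=
  ∃ e : M.carrier ≃ₗ[k] N.carrier, IsHom M N (e : M.carrier →ₗ[k] N.carrier)

/-- `S` is (isomorphic to) the direct sum `A ⊕ B`. -/
def IsDsum (A B S : GSupMod k ι) : Prop :=
  ∃ φ : S.carrier ≃ₗ[k] A.carrier × B.carrier,
    (∀ s, s ∈ S.ev ↔ (φ s).1 ∈ A.ev ∧ (φ s).2 ∈ B.ev) ∧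
    (∀ s, s ∈ S.od ↔ (φ s).1 ∈ A.od ∧ (φ s).2 ∈ B.od) ∧
    ∀ (i : ι) (s : S.carrier),
      φ (S.θ i s) = LinearMap.prodMap (A.θ i) (B.θ i) (φ s)

/-- `M` is (isomorphic to) the trivial supermodule of parity `p`: `k_ev`
for `p = false`, and `k_od = Π(k_ev)` for `p = true`. -/
def IsTrivial (p : Bool) (M : GSupMod k ι) : Prop :=
  Module.finrank k M.carrier = 1 ∧ (∀ i, M.θ i = 0) ∧
    (if p then M.od = ⊤ else M.ev = ⊤)

/-- `M` is indecomposable. -/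
def Indecomposable (M : GSupMod k ι) : Prop :=
  (∃ m : M.carrier, m ≠ 0) ∧
  ∀ A B : GSupMod k ι, IsDsum A B M →
    (∀ a : A.carrier, a = 0) ∨ (∀ b : B.carrier, b = 0)

/-- `M` is a simple supermodule: nonzero, with no proper nonzero graded
invariant submodule. -/
def IsSimple (M : GSupMod k ι) : Prop :=
  (∃ m : M.carrier, m ≠ 0) ∧
  ∀ N : Submodule k M.carrier,
    (∀ i, ∀ m ∈ N, M.θ i m ∈ N) →
    N = (N ⊓ M.ev) ⊔ (N ⊓ M.od) →
    N = ⊥ ∨ N = ⊤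

variable (𝒞 : GSupMod k ι → Prop)

/-- `P` is a projective object of the category cut out by `𝒞` (defined by the
lifting property). -/
def IsProjective (P : GSupMod k ι) : Prop :=
  𝒞 P ∧
  ∀ (M N : GSupMod k ι) (π : M.carrier →ₗ[k] N.carrier)
    (f : P.carrier →ₗ[k] N.carrier),
    𝒞 M → 𝒞 N → IsHom M N π → Function.Surjective π → IsHom P N f →
    ∃ h : P.carrier →ₗ[k] M.carrier, IsHom P M h ∧ π ∘ₗ h = f

/-- `I` is an injective object of the category cut out by `𝒞`. -/
def IsInjective (I : GSupMod k ι) : Prop :=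
  𝒞 I ∧
  ∀ (M N : GSupMod k ι) (j : M.carrier →ₗ[k] N.carrier)
    (f : M.carrier →ₗ[k] I.carrier),
    𝒞 M → 𝒞 N → IsHom M N j → Function.Injective j → IsHom M I f →
    ∃ h : N.carrier →ₗ[k] I.carrier, IsHom N I h ∧ h ∘ₗ j = f

/-- `π : P ↠ M` is a projective cover. -/
def IsProjCover (P M : GSupMod k ι) (π : P.carrier →ₗ[k] M.carrier) : Prop :=
  IsProjective 𝒞 P ∧ IsHom P M π ∧ Function.Surjective π ∧
  ∀ (Q : GSupMod k ι) (f : Q.carrier →ₗ[k] P.carrier),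
    𝒞 Q → IsHom Q P f → Function.Surjective (π ∘ₗ f) → Function.Surjective f

/-- `j : M ↪ I` is an injective hull. -/
def IsInjHull (M I : GSupMod k ι) (j : M.carrier →ₗ[k] I.carrier) : Prop :=
  IsInjective 𝒞 I ∧ IsHom M I j ∧ Function.Injective j ∧
  ∀ (Q : GSupMod k ι) (f : I.carrier →ₗ[k] Q.carrier),
    𝒞 Q → IsHom I Q f → Function.Injective (f ∘ₗ j) → Function.Injective f

/-- `N` is (isomorphic to) the first syzygy `Ω¹(M)`, the kernel of a
projective cover of `M`. -/
def IsSyzygy (M N : GSupMod k ι) : Prop :=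
  𝒞 N ∧
  ∃ (P : GSupMod k ι) (π : P.carrier →ₗ[k] M.carrier)
    (i : N.carrier →ₗ[k] P.carrier),
    IsProjCover 𝒞 P M π ∧ IsHom N P i ∧ Function.Injective i ∧
    LinearMap.range i = LinearMap.ker π

/-- `N` is (isomorphic to) the first cosyzygy `Ω⁻¹(M)`, the cokernel of the
inclusion of `M` into its injective hull. -/
def IsCosyzygy (M N : GSupMod k ι) : Prop :=
  𝒞 N ∧
  ∃ (I : GSupMod k ι) (j : M.carrier →ₗ[k] I.carrier)
    (p : I.carrier →ₗ[k] N.carrier),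
    IsInjHull 𝒞 M I j ∧ IsHom I N p ∧ Function.Surjective p ∧
    LinearMap.ker p = LinearMap.range j

/-- `M` has no nonzero projective direct summand (equivalently, since the
category is self-injective, no nonzero projective submodule). -/
def NoProjSummands (M : GSupMod k ι) : Prop :=
  ∀ A B : GSupMod k ι, IsProjective 𝒞 A → IsDsum A B M → ∀ a : A.carrier, a = 0

/-- `N` is (isomorphic to) `Ω⁰(M)`, the complement of the largest projective
direct summand of `M`. -/
def IsOmegaZero (M N : GSupMod k ι) : Prop :=
  ∃ Q : GSupMod k ι, IsProjective 𝒞 Q ∧ NoProjSummands 𝒞 N ∧ IsDsum N Q M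

/-- `N` is (isomorphic to) `Ωⁿ(M)` for `n ∈ ℕ`. -/
def IsOmegaPow : ℕ → GSupMod k ι → GSupMod k ι → Prop
  | 0, M, N => IsOmegaZero 𝒞 M N
  | n+1, M, N => ∃ L, IsOmegaPow n M L ∧ IsSyzygy 𝒞 L N

/-- `N` is (isomorphic to) `Ω⁻ⁿ(M)` for `n ∈ ℕ`. -/
def IsOmegaNegPow : ℕ → GSupMod k ι → GSupMod k ι → Prop
  | 0, M, N => IsOmegaZero 𝒞 M N
  | n+1, M, N => ∃ L, IsOmegaNegPow n M L ∧ IsCosyzygy 𝒞 L N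

/-- `N` is (isomorphic to) the syzygy `Ωⁿ(M)`, for any `n : ℤ`. -/
def IsOmega (n : ℤ) (M N : GSupMod k ι) : Prop :=
  if 0 ≤ n then IsOmegaPow 𝒞 n.toNat M N else IsOmegaNegPow 𝒞 (-n).toNat M N

/-- `H` is (isomorphic to) the internal Hom supermodule `Hom_k(M,N)` with its
usual grading and the super action of the odd generators
`(θ i · f)(m) = θ i (f m) - (-1)^{|f|} f (θ i m)` (the sign `(-1)^{|f|}` is
expressed via the grading involutions `σ`). -/
def IsHomObj (M N H : GSupMod k ι) : Prop :=
  ∃ φ : H.carrier ≃ₗ[k] (M.carrier →ₗ[k] N.carrier),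
    (∀ h, h ∈ H.ev ↔ ((∀ m ∈ M.ev, φ h m ∈ N.ev) ∧ (∀ m ∈ M.od, φ h m ∈ N.od))) ∧
    (∀ h, h ∈ H.od ↔ ((∀ m ∈ M.ev, φ h m ∈ N.od) ∧ (∀ m ∈ M.od, φ h m ∈ N.ev))) ∧
    ∀ (i : ι) (h : H.carrier),
      φ (H.θ i h) = N.θ i ∘ₗ φ h - (N.sigma ∘ₗ φ h ∘ₗ M.sigma) ∘ₗ M.θ i

/-- `T` is (isomorphic to) the tensor product supermodule `M ⊗_k N` with its
usual grading and the action of the odd generators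
`θ i · (m ⊗ n) = (θ i m) ⊗ n + (-1)^{|m|} m ⊗ (θ i n)`. -/
def IsTensorObj (M N T : GSupMod k ι) : Prop :=
  ∃ φ : T.carrier ≃ₗ[k] TensorProduct k M.carrier N.carrier,
    Submodule.map (φ : T.carrier →ₗ[k] TensorProduct k M.carrier N.carrier) T.ev
      = Submodule.span k
          ({z | ∃ m ∈ M.ev, ∃ n ∈ N.ev, z = m ⊗ₜ[k] n}
            ∪ {z | ∃ m ∈ M.od, ∃ n ∈ N.od, z = m ⊗ₜ[k] n}) ∧
    Submodule.map (φ : T.carrier →ₗ[k] TensorProduct k M.carrier N.carrier) T.od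
      = Submodule.span k
          ({z | ∃ m ∈ M.ev, ∃ n ∈ N.od, z = m ⊗ₜ[k] n}
            ∪ {z | ∃ m ∈ M.od, ∃ n ∈ N.ev, z = m ⊗ₜ[k] n}) ∧
    ∀ (i : ι) (t : T.carrier),
      φ (T.θ i t)
        = TensorProduct.map (M.θ i) (LinearMap.id : N.carrier →ₗ[k] N.carrier) (φ t)
            + TensorProduct.map M.sigma (N.θ i) (φ t)

/-- `D` is (isomorphic to) the dual supermodule `M* = Hom_k(M, k_ev)`, with
the action `(θ i · ψ)(m) = -(-1)^{|ψ|} ψ (θ i m)`. -/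
def IsDualObj (M D : GSupMod k ι) : Prop :=
  ∃ φ : D.carrier ≃ₗ[k] Module.Dual k M.carrier,
    (∀ d, d ∈ D.ev ↔ ∀ m ∈ M.od, φ d m = 0) ∧
    (∀ d, d ∈ D.od ↔ ∀ m ∈ M.ev, φ d m = 0) ∧
    ∀ (i : ι) (d : D.carrier),
      φ (D.θ i d) = - (φ d) ∘ₗ (M.sigma ∘ₗ M.θ i)

/-- `M` is an endotrivial supermodule of the category cut out by `𝒞`:
`Hom_k(M,M) ≅ k_ev ⊕ P` with `P` projective. -/
def IsEndotrivial (M : GSupMod k ι) : Prop :=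
  𝒞 M ∧
  ∃ H K P S : GSupMod k ι, IsHomObj M M H ∧ 𝒞 H ∧ IsTrivial false K ∧
    IsProjective 𝒞 P ∧ IsDsum K P S ∧ Iso H S

/-- `M` and `N` are isomorphic in the stable module category: they become
isomorphic after adding projective direct summands. -/
def StIso (M N : GSupMod k ι) : Prop :=
  ∃ P Q S T : GSupMod k ι, IsProjective 𝒞 P ∧ IsProjective 𝒞 Q ∧
    IsDsum M P S ∧ IsDsum N Q T ∧ Iso S T

/-- `R` is (isomorphic to) the restriction of `M` along the subalgebra of the
odd space spanned by the vectors `ε j`: the same underlying graded vector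
space, where the `j`-th odd generator acts as the element `ε j` did on `M`. -/
def IsRestriction {ι' : Type} [Fintype ι] (ε : ι' → ι → k)
    (M : GSupMod k ι) (R : GSupMod k ι') : Prop :=
  ∃ φ : R.carrier ≃ₗ[k] M.carrier,
    (∀ m, m ∈ R.ev ↔ φ m ∈ M.ev) ∧
    (∀ m, m ∈ R.od ↔ φ m ∈ M.od) ∧
    ∀ (j : ι') (m : R.carrier), φ (R.θ j m) = actOf M (ε j) (φ m)

/-- The radical `Rad(M)` of a supermodule over one of the detecting
superalgebras on the principal block: the span of the images of the odd
generators. -/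
def radical (M : GSupMod k ι) : Submodule k M.carrier :=
  ⨆ i, LinearMap.range (M.θ i)

/-- The rank `Rk(M) = dim_k (M / Rad M)`. -/
def rk (M : GSupMod k ι) : ℕ :=
  Module.finrank k (M.carrier ⧸ radical M)

end GSupMod

open GSupMod

variable {k : Type} [Field k]

/-- The category of supermodules (in the principal block) over the exterior
superalgebra `V(a_r) = Λ((a_r)₁)` on the purely odd abelian `r`-dimensional
space `(a_r)₁`: the odd generators pairwise super-anticommute (in particular
they square to zero).  Complete reducibility over the even part is automatic
since the even part acts by zero. -/
def VCat (k : Type) [Field k] (r : ℕ) : GSupMod k (Fin r) → Prop :=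
  fun M => ∀ i j, M.θ i ∘ₗ M.θ j + M.θ j ∘ₗ M.θ i = 0

/-- The relation on endotrivial supermodules inducing the group `T`: stable
isomorphism. -/
def TRel {ι : Type} (𝒞 : GSupMod k ι → Prop) :
    {M : GSupMod k ι // IsEndotrivial 𝒞 M} →
    {M : GSupMod k ι // IsEndotrivial 𝒞 M} → Prop :=
  fun M N => StIso 𝒞 M.1 N.1

/-- The underlying set of the group `T`: stable isomorphism classes of
endotrivial supermodules. -/
def TGrp {ι : Type} (𝒞 : GSupMod k ι → Prop) : Type 1 := Quot (TRel 𝒞)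

/-- The stable class of an endotrivial supermodule. -/
def tmk {ι : Type} (𝒞 : GSupMod k ι → Prop)
    (M : {M : GSupMod k ι // IsEndotrivial 𝒞 M}) : TGrp 𝒞 :=
  Quot.mk (TRel 𝒞) M

/-- An abelian group structure on `T` whose multiplication, identity and
inverse are induced by tensor product, the trivial module `k_ev` and duality
respectively. -/
structure TGroupData {ι : Type} (𝒞 : GSupMod k ι → Prop) : Type 1 where
  mul : TGrp 𝒞 → TGrp 𝒞 → TGrp 𝒞
  one : TGrp 𝒞
  inv : TGrp 𝒞 → TGrp 𝒞
  mul_assoc : ∀ a b c, mul (mul a b) c = mul a (mul b c)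
  mul_comm : ∀ a b, mul a b = mul b a
  one_mul : ∀ a, mul one a = a
  inv_mul : ∀ a, mul (inv a) a = one
  mul_spec : ∀ (M N : {M : GSupMod k ι // IsEndotrivial 𝒞 M}) (T : GSupMod k ι)
      (_ : IsTensorObj M.1 N.1 T) (hT : IsEndotrivial 𝒞 T),
      mul (tmk 𝒞 M) (tmk 𝒞 N) = tmk 𝒞 ⟨T, hT⟩
  one_spec : ∀ (K : GSupMod k ι) (_ : IsTrivial false K) (hK : IsEndotrivial 𝒞 K),
      one = tmk 𝒞 ⟨K, hK⟩
  inv_spec : ∀ (M : {M : GSupMod k ι // IsEndotrivial 𝒞 M}) (D : GSupMod k ι)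
      (_ : IsDualObj M.1 D) (hD : IsEndotrivial 𝒞 D),
      inv (tmk 𝒞 M) = tmk 𝒞 ⟨D, hD⟩

end SupCat

set_option linter.unusedSectionVars false
namespace SupAux
open SupCat SupCat.GSupMod

section basics
variable {k : Type} [Field k] {ι : Type}

lemma sigma_of_ev (M : GSupMod k ι) {m : M.carrier} (h : m ∈ M.ev) : M.sigma m = m := by
  have h1 : Submodule.projectionOnto M.ev M.od M.isCompl m = ⟨m, h⟩ :=
    Submodule.projectionOnto_apply_left M.isCompl ⟨m, h⟩
  have h2 : Submodule.projectionOnto M.od M.ev M.isCompl.symm m = 0 :=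
    Submodule.projectionOnto_apply_of_mem_right M.isCompl.symm h
  simp only [sigma, LinearMap.sub_apply, LinearMap.comp_apply]
  erw [h1, h2]; simp

lemma sigma_of_od (M : GSupMod k ι) {m : M.carrier} (h : m ∈ M.od) : M.sigma m = -m := by
  have h1 : Submodule.projectionOnto M.od M.ev M.isCompl.symm m = ⟨m, h⟩ :=
    Submodule.projectionOnto_apply_left M.isCompl.symm ⟨m, h⟩
  have h2 : Submodule.projectionOnto M.ev M.od M.isCompl m = 0 :=
    Submodule.projectionOnto_apply_of_mem_right M.isCompl h
  simp only [sigma, LinearMap.sub_apply, LinearMap.comp_apply]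
  erw [h1, h2]; simp

lemma exists_parts (M : GSupMod k ι) (m : M.carrier) :
    ∃ a ∈ M.ev, ∃ b ∈ M.od, a + b = m :=
  Submodule.mem_sup.1 (by rw [M.isCompl.sup_eq_top]; trivial)

lemma sigma_sigma (M : GSupMod k ι) (m : M.carrier) : M.sigma (M.sigma m) = m := by
  obtain ⟨a, ha, b, hb, rfl⟩ := exists_parts M m
  simp [sigma_of_ev M ha, sigma_of_od M hb]

lemma sigma_theta (M : GSupMod k ι) (i : ι) (m : M.carrier) :
    M.sigma (M.θ i m) = - M.θ i (M.sigma m) := by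
  obtain ⟨a, ha, b, hb, rfl⟩ := exists_parts M m
  simp [sigma_of_ev M ha, sigma_of_od M hb, sigma_of_od M (M.θ_ev i a ha),
    sigma_of_ev M (M.θ_od i b hb), add_comm]

lemma sigma_actOf [Fintype ι] (M : GSupMod k ι) (w : ι → k) (m : M.carrier) :
    M.sigma (actOf M w m) = - actOf M w (M.sigma m) := by
  simp [actOf, sigma_theta]

variable [CharZero k]

lemma self_eq_neg_zero {U : Type} [AddCommGroup U] [Module k U] {u : U} (h : u = -u) : u = 0 := by
  have : (2 : k) • u = 0 := by rw [two_smul]; nth_rewrite 1 [h]; simp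
  exact (smul_eq_zero.1 this).resolve_left two_ne_zero

lemma mem_ev_iff (M : GSupMod k ι) (m : M.carrier) : m ∈ M.ev ↔ M.sigma m = m := by
  refine ⟨sigma_of_ev M, fun h => ?_⟩
  obtain ⟨a, ha, b, hb, rfl⟩ := exists_parts M m
  simp only [map_add, sigma_of_ev M ha, sigma_of_od M hb] at h
  have : b = 0 := self_eq_neg_zero (k := k) (add_left_cancel h).symm
  simpa [this] using ha

lemma mem_od_iff (M : GSupMod k ι) (m : M.carrier) : m ∈ M.od ↔ M.sigma m = -m := by
  refine ⟨sigma_of_od M, fun h => ?_⟩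
  obtain ⟨a, ha, b, hb, rfl⟩ := exists_parts M m
  simp only [map_add, sigma_of_ev M ha, sigma_of_od M hb, neg_add] at h
  have : a = 0 := self_eq_neg_zero (k := k) (add_right_cancel h)
  simpa [this] using hb

/-- Supermodule built from a grading involution. -/
def mkS (U : Type) [AddCommGroup U] [Module k U] [FiniteDimensional k U]
    (σ : U →ₗ[k] U) (hσ : ∀ u, σ (σ u) = u) (θ : ι → U →ₗ[k] U)
    (hθ : ∀ i u, σ (θ i u) = - θ i (σ u)) : GSupMod k ι where
  carrier := U
  ev := LinearMap.ker (σ - LinearMap.id)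
  od := LinearMap.ker (σ + LinearMap.id)
  isCompl := by
    constructor
    · rw [Submodule.disjoint_def]
      intro u h1 h2
      simp only [LinearMap.mem_ker, LinearMap.sub_apply, LinearMap.add_apply, LinearMap.id_apply,
        sub_eq_zero] at h1 h2
      rw [h1] at h2
      exact self_eq_neg_zero (k := k) (eq_neg_of_add_eq_zero_left h2)
    · rw [codisjoint_iff, eq_top_iff]
      intro u _
      refine Submodule.mem_sup.2 ⟨(2⁻¹ : k) • (u + σ u), ?_, (2⁻¹ : k) • (u - σ u), ?_, ?_⟩
      · simp [hσ, add_comm]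
      · simp [hσ]
      · rw [← smul_add, add_add_sub_cancel, ← two_smul k u, smul_smul]; simp
  θ := θ
  θ_ev := by
    intro i m hm
    simp only [LinearMap.mem_ker, LinearMap.sub_apply, LinearMap.add_apply, LinearMap.id_apply,
        sub_eq_zero] at hm ⊢
    rw [hθ, hm]; simp
  θ_od := by
    intro i m hm
    simp only [LinearMap.mem_ker, LinearMap.sub_apply, LinearMap.add_apply, LinearMap.id_apply,
        sub_eq_zero] at hm ⊢
    rw [hθ, eq_neg_of_add_eq_zero_left hm]; simp

lemma mkS_sigma (U : Type) [AddCommGroup U] [Module k U] [FiniteDimensional k U]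
    (σ : U →ₗ[k] U) (hσ : ∀ u, σ (σ u) = u) (θ : ι → U →ₗ[k] U)
    (hθ : ∀ i u, σ (θ i u) = - θ i (σ u)) (u : U) :
    (mkS U σ hσ θ hθ).sigma u = σ u := by
  obtain ⟨a, ha, b, hb, rfl⟩ := exists_parts (mkS U σ hσ θ hθ) u
  rw [map_add, sigma_of_ev _ ha, sigma_of_od _ hb]
  have h1 : σ a = a := sub_eq_zero.1 ha
  have h2 : σ b = -b := eq_neg_of_add_eq_zero_left hb
  exact (congrArg₂ (· + ·) h1.symm h2.symm).trans (map_add σ a b).symm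

lemma isHom_iff (M N : GSupMod k ι) (f : M.carrier →ₗ[k] N.carrier) :
    IsHom M N f ↔ (∀ i m, f (M.θ i m) = N.θ i (f m)) ∧ ∀ m, f (M.sigma m) = N.sigma (f m) := by
  constructor
  · rintro ⟨h1, h2, h3⟩
    refine ⟨fun i m => LinearMap.congr_fun (h1 i) m, fun m => ?_⟩
    obtain ⟨a, ha, b, hb, rfl⟩ := exists_parts M m
    simp [sigma_of_ev M ha, sigma_of_od M hb, sigma_of_ev N (h2 a ha), sigma_of_od N (h3 b hb)]
  · rintro ⟨h1, h2⟩
    refine ⟨fun i => LinearMap.ext (h1 i), fun m hm => ?_, fun m hm => ?_⟩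
    · rw [mem_ev_iff, ← h2, sigma_of_ev M hm]
    · rw [mem_od_iff, ← h2, sigma_of_od M hm, map_neg]

lemma isDsum_of (A B S : GSupMod k ι) (φ : S.carrier ≃ₗ[k] A.carrier × B.carrier)
    (h1 : ∀ s, φ (S.sigma s) = (A.sigma (φ s).1, B.sigma (φ s).2))
    (h2 : ∀ i s, φ (S.θ i s) = (A.θ i (φ s).1, B.θ i (φ s).2)) : IsDsum A B S := by
  refine ⟨φ, fun s => ?_, fun s => ?_, fun i s => by rw [h2]; rfl⟩
  · rw [mem_ev_iff, mem_ev_iff, mem_ev_iff, ← φ.injective.eq_iff, h1, Prod.ext_iff]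
  · rw [mem_od_iff, mem_od_iff, mem_od_iff, ← φ.injective.eq_iff, h1, map_neg, Prod.ext_iff]
    rfl

lemma actOf_comp [Fintype ι] {M : GSupMod k ι} (v w : ι → k)
    (hM : ∀ i j, M.θ i ∘ₗ M.θ j + M.θ j ∘ₗ M.θ i = 0) :
    actOf M v ∘ₗ actOf M w + actOf M w ∘ₗ actOf M v = 0 := by
  have e1 : actOf M v ∘ₗ actOf M w = ∑ i, ∑ j, (v i * w j) • (M.θ i ∘ₗ M.θ j) := by
    ext m
    simp [actOf, LinearMap.sum_apply, map_sum, Finset.smul_sum, mul_smul]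
  have e2 : actOf M w ∘ₗ actOf M v = ∑ i, ∑ j, (v i * w j) • (M.θ j ∘ₗ M.θ i) := by
    ext m
    simp only [actOf, LinearMap.sum_apply, map_sum, Finset.smul_sum, mul_smul, LinearMap.comp_apply,
      LinearMap.smul_apply, map_smul]
  rw [e1, e2, ← Finset.sum_add_distrib]
  refine Finset.sum_eq_zero fun i _ => ?_
  rw [← Finset.sum_add_distrib]
  refine Finset.sum_eq_zero fun j _ => ?_
  rw [← smul_add, hM, smul_zero]

lemma actOf_sq [Fintype ι] {M : GSupMod k ι} (v : ι → k)
    (hM : ∀ i j, M.θ i ∘ₗ M.θ j + M.θ j ∘ₗ M.θ i = 0) (m : M.carrier) :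
    actOf M v (actOf M v m) = 0 := by
  have := LinearMap.congr_fun (actOf_comp v v hM) m
  exact self_eq_neg_zero (k := k) (eq_neg_of_add_eq_zero_left this)

lemma actOf_hom [Fintype ι] {M N : GSupMod k ι} {f : M.carrier →ₗ[k] N.carrier}
    (h : ∀ i m, f (M.θ i m) = N.θ i (f m)) (v : ι → k) (m : M.carrier) :
    f (actOf M v m) = actOf N v (f m) := by
  simp [actOf, h]

/-- A supermodule with prescribed involution and odd operators. -/
lemma exists_mod (U : Type) [AddCommGroup U] [Module k U] [FiniteDimensional k U]
    (σ : U →ₗ[k] U) (hσ : ∀ u, σ (σ u) = u) (θ : ι → U →ₗ[k] U)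
    (hθ : ∀ i u, σ (θ i u) = - θ i (σ u)) :
    ∃ (Q : GSupMod k ι) (e : Q.carrier ≃ₗ[k] U),
      (∀ q, e (Q.sigma q) = σ (e q)) ∧ ∀ i q, e (Q.θ i q) = θ i (e q) :=
  ⟨mkS U σ hσ θ hθ, LinearEquiv.refl k U, mkS_sigma U σ hσ θ hθ, fun _ _ => rfl⟩

lemma vcat_iff {r : ℕ} (M : GSupMod k (Fin r)) :
    VCat k r M ↔ ∀ i j m, M.θ i (M.θ j m) = - M.θ j (M.θ i m) := by
  constructor
  · intro h i j m
    exact eq_neg_of_add_eq_zero_left (LinearMap.congr_fun (h i j) m)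
  · intro h i j
    ext1 m
    simp [h i j m]

lemma vcat_of {r : ℕ} {U : Type} [AddCommGroup U] [Module k U] {Q : GSupMod k (Fin r)}
    (e : Q.carrier ≃ₗ[k] U) {θ : Fin r → U →ₗ[k] U} (h : ∀ i q, e (Q.θ i q) = θ i (e q))
    (hθ : ∀ i j u, θ i (θ j u) = - θ j (θ i u)) : VCat k r Q := by
  rw [vcat_iff]
  intro i j m
  apply e.injective
  rw [h, h, hθ, map_neg, h, h]

/-- Projective objects are exact with respect to each nonzero odd element. -/
lemma proj_exact {r : ℕ} {P : GSupMod k (Fin r)} (hP : IsProjective (VCat k r) P)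
    (w : Fin r → k) (hw : w ≠ 0) (p : P.carrier) (hp : actOf P w p = 0) :
    ∃ q, actOf P w q = p := by
  obtain ⟨i₀, hi₀⟩ := Function.ne_iff.1 hw
  obtain ⟨c, hcw⟩ : ∃ c : Fin r → k, ∑ i, w i * c i = 1 := by
    refine ⟨Pi.single i₀ (w i₀)⁻¹, ?_⟩
    rw [Finset.sum_eq_single i₀]
    · simp only [Pi.single_eq_same]; exact mul_inv_cancel₀ hi₀
    · intro b _ hb; simp [hb]
    · simp
  obtain ⟨σ, hσa⟩ : ∃ σ : P.carrier × P.carrier →ₗ[k] P.carrier × P.carrier,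
      ∀ a b, σ (a, b) = (P.sigma a, - P.sigma b) :=
    ⟨LinearMap.prodMap P.sigma (-P.sigma), fun _ _ => rfl⟩
  obtain ⟨θ, hθa⟩ : ∃ θ : Fin r → P.carrier × P.carrier →ₗ[k] P.carrier × P.carrier,
      ∀ i a b, θ i (a, b) = (P.θ i a, c i • P.sigma a + P.θ i b) :=
    ⟨fun i => LinearMap.prod (P.θ i ∘ₗ LinearMap.fst k _ _)
      (c i • P.sigma ∘ₗ LinearMap.fst k _ _ + P.θ i ∘ₗ LinearMap.snd k _ _), fun _ _ _ => rfl⟩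
  have hPa := (vcat_iff P).1 hP.1
  obtain ⟨Q, e, h1, h2⟩ := exists_mod _ σ
    (by rintro ⟨a, b⟩; simp [hσa, sigma_sigma]) θ
    (by rintro i ⟨a, b⟩; simp [hσa, hθa, sigma_sigma, sigma_theta, add_comm])
  have hQ : VCat k r Q := by
    refine vcat_of e h2 ?_
    rintro i j ⟨a, b⟩
    simp only [hθa, Prod.neg_mk, map_add, map_smul, sigma_theta, smul_neg]
    rw [hPa i j a, hPa i j b]
    refine Prod.ext rfl ?_
    simp only
    abel
  have he : ∀ q i, (e (Q.θ i q)).1 = P.θ i (e q).1 := by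
    intro q i
    rw [h2]
    obtain ⟨a, b⟩ := e q
    rw [hθa]
  have hes : ∀ q, (e (Q.sigma q)).1 = P.sigma (e q).1 := by
    intro q
    rw [h1]
    obtain ⟨a, b⟩ := e q
    rw [hσa]
  obtain ⟨h, hh, hsec⟩ := hP.2 Q P (LinearMap.fst k _ _ ∘ₗ e.toLinearMap) LinearMap.id hQ hP.1
    ((isHom_iff _ _ _).2 ⟨fun i q => he q i, hes⟩)
    (fun a => ⟨e.symm (a, 0), by simp⟩) ((isHom_iff _ _ _).2 ⟨fun _ _ => rfl, fun _ => rfl⟩)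
  have hact : ∀ q, (e (actOf Q w q)).2 = P.sigma (e q).1 + actOf P w (e q).2 := by
    intro q
    have : e (actOf Q w q) = ∑ i, w i • θ i (e q) := by
      simp [actOf, LinearMap.sum_apply, map_sum, h2]
    rw [this]
    obtain ⟨a, b⟩ := e q
    simp only [hθa, Prod.snd_sum, Prod.smul_mk, 
        smul_add, Finset.sum_add_distrib, actOf, LinearMap.sum_apply, smul_smul, ← Finset.sum_smul,
        hcw, one_smul, LinearMap.smul_apply]
  have h0 : actOf Q w (h p) = 0 := by
    rw [← actOf_hom ((isHom_iff _ _ _).1 hh).1, hp, map_zero]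
  have h2 := hact (h p)
  rw [h0] at h2
  have h3 : (e (h p)).1 = p := LinearMap.congr_fun hsec p
  rw [h3, map_zero] at h2
  refine ⟨P.sigma (e (h p)).2, ?_⟩
  have h4 : P.sigma p = - actOf P w (e (h p)).2 := eq_neg_of_add_eq_zero_left h2.symm
  have h5 := sigma_sigma P p
  rw [h4, map_neg, sigma_actOf, neg_neg] at h5
  exact h5

end basics

/-- For an endotrivial module every nonzero odd element has one dimensional homology. -/
lemma endotrivial_ch {k : Type} [Field k] [CharZero k] {r : ℕ} {M : GSupMod k (Fin r)}
    (hE : IsEndotrivial (VCat k r) M) (w : Fin r → k) (hw : w ≠ 0) :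
    2 * Module.finrank k (LinearMap.ker (actOf M w)) = Module.finrank k M.carrier + 1 := by
  obtain ⟨hM, H, K, P, S, ⟨φ, -, -, hφ⟩, -, hK, hP, ⟨ψ, -, -, hψ⟩, ⟨e, he⟩⟩ := hE
  set x := actOf M w with hx
  have hxx : ∀ m, x (x m) = 0 := actOf_sq w hM
  have hxs : ∀ m, M.sigma (x m) = - x (M.sigma m) := sigma_actOf M w
  -- the equivalence of the endomorphism module with `K × P`
  obtain ⟨Θ, hΘ⟩ : ∃ Θ : (M.carrier →ₗ[k] M.carrier) ≃ₗ[k] K.carrier × P.carrier,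
      ∀ f, Θ (x ∘ₗ f - (M.sigma ∘ₗ f ∘ₗ M.sigma) ∘ₗ x) = (0, actOf P w (Θ f).2) := by
    refine ⟨φ.symm.trans (e.trans ψ), fun f => ?_⟩
    obtain ⟨h, rfl⟩ := φ.surjective f
    have h1 : x ∘ₗ φ h - (M.sigma ∘ₗ φ h ∘ₗ M.sigma) ∘ₗ x = φ (actOf H w h) := by
      simp only [actOf, LinearMap.sum_apply, map_sum, LinearMap.smul_apply, map_smul, hφ, hx]
      simp only [smul_sub, Finset.sum_sub_distrib]
      congr 1
      · ext m; simp [LinearMap.sum_apply]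
      · ext m; simp [LinearMap.sum_apply, map_sum]
    rw [h1]
    have h2 : e (actOf H w h) = actOf S w (e h) := by
      have := actOf_hom (fun i m => ((isHom_iff _ _ _).1 he).1 i m) w h
      simpa using this
    simp only [LinearEquiv.trans_apply, LinearEquiv.symm_apply_apply, h2]
    simp only [actOf, LinearMap.sum_apply, map_sum, LinearMap.smul_apply, map_smul, hψ]
    refine Prod.ext ?_ ?_
    · simp [Prod.fst_sum, hK.2.1]
    · simp [Prod.snd_sum]
  have hPe : LinearMap.ker (actOf P w) = LinearMap.range (actOf P w) := by
    apply le_antisymm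
    · intro p hp
      exact proj_exact hP w hw p hp
    · rintro _ ⟨q, rfl⟩
      exact actOf_sq w hP.1 q
  have hodd : ∃ c, Module.finrank k M.carrier * Module.finrank k M.carrier = 2 * c + 1 := by
    refine ⟨Module.finrank k (LinearMap.ker (actOf P w)), ?_⟩
    rw [← Module.finrank_linearMap k k M.carrier M.carrier, Θ.finrank_eq, Module.finrank_prod,
      hK.1, ← LinearMap.finrank_range_add_finrank_ker (actOf P w), ← hPe]
    ring
  have hrn := LinearMap.finrank_range_add_finrank_ker x
  have hle : LinearMap.range x ≤ LinearMap.ker x := by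
    rintro _ ⟨m, rfl⟩; exact hxx m
  have hne : ¬ LinearMap.ker x ≤ LinearMap.range x := by
    intro h
    rw [le_antisymm h hle] at hrn
    obtain ⟨c, hc⟩ := hodd
    rw [← hrn] at hc
    have := congrArg (· % 2) hc
    ring_nf at this
    omega
  obtain ⟨z, hz, hz'⟩ := Set.not_subset.1 hne
  obtain ⟨ζ₀, hζ₀, hζ₁⟩ := Submodule.exists_dual_map_eq_bot_of_notMem hz' inferInstance
  obtain ⟨ζ, hζz, hζx⟩ : ∃ ζ : Module.Dual k M.carrier, ζ z = 1 ∧ ∀ m, ζ (x m) = 0 := by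
    refine ⟨(ζ₀ z)⁻¹ • ζ₀, by simp [inv_mul_cancel₀ hζ₀], fun m => ?_⟩
    have : ζ₀ (x m) = 0 := by
      have : ζ₀ (x m) ∈ (LinearMap.range x).map ζ₀ := ⟨x m, ⟨m, rfl⟩, rfl⟩
      rwa [hζ₁] at this
    simp [this]
  have hz0 : x z = 0 := hz
  -- the two cycles
  set f₁ : M.carrier →ₗ[k] M.carrier := LinearMap.id with hf₁
  set f₂ : M.carrier →ₗ[k] M.carrier := LinearMap.smulRight ζ z with hf₂
  have c₁ : x ∘ₗ f₁ - (M.sigma ∘ₗ f₁ ∘ₗ M.sigma) ∘ₗ x = 0 := by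
    ext m; simp [hf₁, sigma_sigma]
  have c₂ : x ∘ₗ f₂ - (M.sigma ∘ₗ f₂ ∘ₗ M.sigma) ∘ₗ x = 0 := by
    ext m; simp [hf₂, hz0, hxs, hζx]
  have d₁ : actOf P w (Θ f₁).2 = 0 := by
    have := hΘ f₁; rw [c₁, map_zero] at this; exact (Prod.ext_iff.1 this).2.symm
  have d₂ : actOf P w (Θ f₂).2 = 0 := by
    have := hΘ f₂; rw [c₂, map_zero] at this; exact (Prod.ext_iff.1 this).2.symm
  obtain ⟨a, b, hab, hk⟩ : ∃ a b : k, (a ≠ 0 ∨ b ≠ 0) ∧ a • (Θ f₁).1 + b • (Θ f₂).1 = 0 := by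
    by_cases h : (Θ f₁).1 = 0
    · exact ⟨1, 0, Or.inl one_ne_zero, by simp [h]⟩
    · obtain ⟨c, hc⟩ := (finrank_eq_one_iff_of_nonzero' _ h).1 hK.1 (Θ f₂).1
      exact ⟨c, -1, Or.inr (by simp), by rw [hc]; simp⟩
  obtain ⟨q, hq⟩ := proj_exact hP w hw (a • (Θ f₁).2 + b • (Θ f₂).2) (by simp [d₁, d₂])
  obtain ⟨g, hg⟩ := Θ.surjective (0, q)
  have hbd : a • f₁ + b • f₂ = x ∘ₗ g - (M.sigma ∘ₗ g ∘ₗ M.sigma) ∘ₗ x := by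
    apply Θ.injective
    rw [hΘ, hg, map_add, map_smul, map_smul]
    refine Prod.ext ?_ ?_
    · simpa using hk
    · simpa using hq.symm
  have key : ∀ m, x m = 0 → a • m + (b * ζ m) • z ∈ LinearMap.range x := by
    intro m hm
    have := LinearMap.congr_fun hbd m
    simp only [hf₁, hf₂, LinearMap.add_apply, LinearMap.smul_apply, LinearMap.id_apply,
      LinearMap.smulRight_apply, LinearMap.sub_apply, LinearMap.comp_apply, hm, map_zero,
      sub_zero] at this
    rw [mul_smul, this]
    exact ⟨_, rfl⟩
  have hab' : a + b = 0 := by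
    by_contra h
    have := key z hz0
    rw [hζz, mul_one, ← add_smul] at this
    exact hz' ((Submodule.smul_mem_iff _ h).1 this)
  have ha : a ≠ 0 := by
    rintro rfl
    rw [zero_add] at hab'
    simp [hab'] at hab
  have hker : LinearMap.ker x = LinearMap.range x ⊔ Submodule.span k {z} := by
    apply le_antisymm
    · intro m hm
      have h1 := key m hm
      have h2 : m = a⁻¹ • (a • m + (b * ζ m) • z) + (-(a⁻¹ * (b * ζ m))) • z := by
        rw [smul_add, smul_smul, inv_mul_cancel₀ ha, one_smul, smul_smul, neg_smul]; abel
      rw [h2]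
      exact Submodule.add_mem_sup (Submodule.smul_mem _ _ h1)
        (Submodule.smul_mem _ _ (Submodule.mem_span_singleton_self z))
    · refine sup_le hle ?_
      rw [Submodule.span_singleton_le_iff_mem]; exact hz
  have hinf : LinearMap.range x ⊓ Submodule.span k {z} = ⊥ := by
    rw [eq_bot_iff]
    rintro m ⟨h1, h2⟩
    obtain ⟨c, rfl⟩ := Submodule.mem_span_singleton.1 h2
    by_cases hc : c = 0
    · simp [hc]
    · exact absurd ((Submodule.smul_mem_iff _ hc).1 h1) hz'
  have hzne : z ≠ 0 := by rintro rfl; exact hz' (Submodule.zero_mem _)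
  have hfin := Submodule.finrank_sup_add_finrank_inf_eq (LinearMap.range x) (Submodule.span k {z})
  rw [← hker, hinf, finrank_bot, finrank_span_singleton hzne] at hfin
  omega

end SupAux

set_option linter.unusedSectionVars false
namespace SupAux
open SupCat SupCat.GSupMod

section ranktwo
variable {k : Type} [Field k] [CharZero k]

lemma vcat_two_iff (M : GSupMod k (Fin 2)) :
    VCat k 2 M ↔ (∀ m, M.θ 0 (M.θ 0 m) = 0) ∧ (∀ m, M.θ 1 (M.θ 1 m) = 0) ∧
      ∀ m, M.θ 0 (M.θ 1 m) = - M.θ 1 (M.θ 0 m) := by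
  rw [vcat_iff]
  constructor
  · intro h
    exact ⟨fun m => self_eq_neg_zero (k := k) (h 0 0 m),
      fun m => self_eq_neg_zero (k := k) (h 1 1 m), h 0 1⟩
  · rintro ⟨h0, h1, h2⟩ i j m
    fin_cases i <;> fin_cases j
    · simp [h0]
    · exact h2 m
    · simp [h2 m]
    · simp [h1]

lemma isHom_two_iff (M N : GSupMod k (Fin 2)) (f : M.carrier →ₗ[k] N.carrier) :
    IsHom M N f ↔ (∀ m, f (M.θ 0 m) = N.θ 0 (f m)) ∧ (∀ m, f (M.θ 1 m) = N.θ 1 (f m)) ∧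
      ∀ m, f (M.sigma m) = N.sigma (f m) := by
  rw [isHom_iff, Fin.forall_fin_two, and_assoc]

/-- Two odd anticommuting operators give a rank two supermodule. -/
lemma exists_mod_two (U : Type) [AddCommGroup U] [Module k U] [FiniteDimensional k U]
    (σ x y : U →ₗ[k] U) (hσ : ∀ u, σ (σ u) = u)
    (hx : ∀ u, σ (x u) = - x (σ u)) (hy : ∀ u, σ (y u) = - y (σ u))
    (hxx : ∀ u, x (x u) = 0) (hyy : ∀ u, y (y u) = 0) (hxy : ∀ u, x (y u) = - y (x u)) :
    ∃ (Q : GSupMod k (Fin 2)) (e : Q.carrier ≃ₗ[k] U),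
      VCat k 2 Q ∧ (∀ q, e (Q.sigma q) = σ (e q)) ∧ (∀ q, e (Q.θ 0 q) = x (e q)) ∧
      (∀ q, e (Q.θ 1 q) = y (e q)) := by
  obtain ⟨Q, e, h1, h2⟩ := exists_mod U σ hσ ![x, y] (by
    intro i u; fin_cases i
    · exact hx u
    · exact hy u)
  have h3 : ∀ q, e (Q.θ 0 q) = x (e q) := h2 0
  have h4 : ∀ q, e (Q.θ 1 q) = y (e q) := h2 1
  refine ⟨Q, e, (vcat_two_iff Q).2 ⟨?_, ?_, ?_⟩, h1, h3, h4⟩ <;> intro m <;> apply e.injective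
  · simp [h3, hxx]
  · simp [h4, hyy]
  · simp [h3, h4, hxy]

section avg
variable {A B : Type} [AddCommGroup A] [Module k A] [AddCommGroup B] [Module k B]

lemma half_add (u : A) : (2⁻¹ : k) • (u + u) = u := by
  rw [← two_smul k u, smul_smul]; simp

lemma avg_section (σA : A →ₗ[k] A) (σB : B →ₗ[k] B)
    (hA : ∀ u, σA (σA u) = u) (hB : ∀ u, σB (σB u) = u)
    (π : A →ₗ[k] B) (hπ : Function.Surjective π) (h : ∀ a, π (σA a) = σB (π a)) :
    ∃ s : B →ₗ[k] A, (∀ b, π (s b) = b) ∧ ∀ b, s (σB b) = σA (s b) := by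
  obtain ⟨s, hs⟩ := LinearMap.exists_rightInverse_of_surjective π (LinearMap.range_eq_top.2 hπ)
  have hs' : ∀ b, π (s b) = b := LinearMap.congr_fun hs
  refine ⟨(2⁻¹ : k) • (s + σA ∘ₗ s ∘ₗ σB), fun b => ?_, fun b => ?_⟩
  · simp only [LinearMap.smul_apply, LinearMap.add_apply, LinearMap.comp_apply, map_smul, map_add,
      h, hs', hB, half_add]
  · simp only [LinearMap.smul_apply, LinearMap.add_apply, LinearMap.comp_apply, map_smul, map_add,
      hB, hA, add_comm]

lemma avg_retraction (σA : A →ₗ[k] A) (σB : B →ₗ[k] B)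
    (hA : ∀ u, σA (σA u) = u) (hB : ∀ u, σB (σB u) = u)
    (j : A →ₗ[k] B) (hj : Function.Injective j) (h : ∀ a, j (σA a) = σB (j a)) :
    ∃ s : B →ₗ[k] A, (∀ a, s (j a) = a) ∧ ∀ b, s (σB b) = σA (s b) := by
  obtain ⟨s, hs⟩ := LinearMap.exists_leftInverse_of_injective j (LinearMap.ker_eq_bot.2 hj)
  have hs' : ∀ b, s (j b) = b := LinearMap.congr_fun hs
  refine ⟨(2⁻¹ : k) • (s + σA ∘ₗ s ∘ₗ σB), fun b => ?_, fun b => ?_⟩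
  · simp only [LinearMap.smul_apply, LinearMap.add_apply, LinearMap.comp_apply, ← h, hs', hA, 
      half_add]
  · simp only [LinearMap.smul_apply, LinearMap.add_apply, LinearMap.comp_apply, map_smul, map_add,
      hB, hA, add_comm]
end avg

/-- `Q` is the free module on the graded space `(V, s)`, with coordinates `ε`. -/
def IsFr (V : Type) [AddCommGroup V] [Module k V] (s : V →ₗ[k] V) (Q : GSupMod k (Fin 2))
    (ε : (V × V × V × V) ≃ₗ[k] Q.carrier) : Prop :=
  (∀ a b c d, Q.sigma (ε (a, b, c, d)) = ε (s a, - s b, - s c, s d)) ∧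
  (∀ a b c d, Q.θ 0 (ε (a, b, c, d)) = ε (0, a, 0, c)) ∧
  (∀ a b c d, Q.θ 1 (ε (a, b, c, d)) = ε (0, 0, a, -b))

variable {V : Type} [AddCommGroup V] [Module k V] {s : V →ₗ[k] V}

lemma fr_exists [FiniteDimensional k V] (hs : ∀ v, s (s v) = v) :
    ∃ Q ε, IsFr V s Q ε := by
  obtain ⟨σ, hσ⟩ : ∃ σ : (V × V × V × V) →ₗ[k] (V × V × V × V),
      ∀ a b c d, σ (a, b, c, d) = (s a, - s b, - s c, s d) :=
    ⟨s.prodMap ((-s).prodMap ((-s).prodMap s)), fun _ _ _ _ => rfl⟩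
  obtain ⟨x, hx⟩ : ∃ x : (V × V × V × V) →ₗ[k] (V × V × V × V),
      ∀ a b c d, x (a, b, c, d) = (0, a, 0, c) :=
    ⟨{ toFun := fun p => (0, p.1, 0, p.2.2.1)
       map_add' := by intro p q; simp
       map_smul' := by intro p q; simp }, fun _ _ _ _ => rfl⟩
  obtain ⟨y, hy⟩ : ∃ y : (V × V × V × V) →ₗ[k] (V × V × V × V),
      ∀ a b c d, y (a, b, c, d) = (0, 0, a, -b) :=
    ⟨{ toFun := fun p => (0, 0, p.1, - p.2.1)
       map_add' := by intro p q; simp [add_comm]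
       map_smul' := by intro p q; simp }, fun _ _ _ _ => rfl⟩
  obtain ⟨Q, e, -, h1, h2, h3⟩ := exists_mod_two _ σ x y
    (by rintro ⟨a, b, c, d⟩; simp [hσ, hs])
    (by rintro ⟨a, b, c, d⟩; simp [hσ, hx])
    (by rintro ⟨a, b, c, d⟩; simp [hσ, hy])
    (by rintro ⟨a, b, c, d⟩; simp [hx])
    (by rintro ⟨a, b, c, d⟩; simp [hy])
    (by rintro ⟨a, b, c, d⟩; simp [hx, hy])
  refine ⟨Q, e.symm, ?_, ?_, ?_⟩ <;> intro a b c d <;> apply e.injective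
  · simp [h1, hσ]
  · simp [h2, hx]
  · simp [h3, hy]

section fr
variable {Q : GSupMod k (Fin 2)} {ε : (V × V × V × V) ≃ₗ[k] Q.carrier}

lemma fr_vcat (h : IsFr V s Q ε) : VCat k 2 Q := by
  obtain ⟨h1, h2, h3⟩ := h
  rw [vcat_two_iff]
  refine ⟨?_, ?_, ?_⟩ <;> intro m <;> obtain ⟨⟨a, b, c, d⟩, rfl⟩ := ε.surjective m
  · simp [h2, Prod.mk_zero_zero]
  · simp [h3, Prod.mk_zero_zero]
  · rw [h3, h2, h2, h3, ← map_neg]; simp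

lemma fr_map_expand (h : IsFr V s Q ε) {N : GSupMod k (Fin 2)} {f : Q.carrier →ₗ[k] N.carrier}
    (hf : IsHom Q N f) (a b c d : V) :
    f (ε (a, b, c, d)) = f (ε (a, 0, 0, 0)) + N.θ 0 (f (ε (b, 0, 0, 0)))
      + N.θ 1 (f (ε (c, 0, 0, 0))) + N.θ 0 (N.θ 1 (f (ε (d, 0, 0, 0)))) := by
  obtain ⟨h1, h2, h3⟩ := h
  obtain ⟨f1, f2, f3⟩ := (isHom_two_iff _ _ _).1 hf
  rw [← f1, ← f2, ← f2, ← f1, h2, h3, h3, h2, ← map_add, ← map_add, ← map_add,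
    ← map_add, ← map_add, ← map_add]
  simp

/-- the map out of a free module determined by a graded map `g` -/
lemma fr_lift (h : IsFr V s Q ε) {M : GSupMod k (Fin 2)} (hM : VCat k 2 M)
    (g : V →ₗ[k] M.carrier) (hg : ∀ v, g (s v) = M.sigma (g v)) :
    ∃ f : Q.carrier →ₗ[k] M.carrier, IsHom Q M f ∧ ∀ a b c d, f (ε (a, b, c, d)) =
      g a + M.θ 0 (g b) + M.θ 1 (g c) + M.θ 0 (M.θ 1 (g d)) := by
  obtain ⟨h1, h2, h3⟩ := h
  obtain ⟨m1, m2, m3⟩ := (vcat_two_iff M).1 hM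
  let F : (V × V × V × V) →ₗ[k] M.carrier :=
    g.coprod ((M.θ 0 ∘ₗ g).coprod ((M.θ 1 ∘ₗ g).coprod (M.θ 0 ∘ₗ M.θ 1 ∘ₗ g)))
  have hF : ∀ a b c d, (F ∘ₗ ε.symm.toLinearMap) (ε (a, b, c, d)) =
      g a + M.θ 0 (g b) + M.θ 1 (g c) + M.θ 0 (M.θ 1 (g d)) := by
    intro a b c d
    simp [F, add_assoc]
  refine ⟨F ∘ₗ ε.symm.toLinearMap, (isHom_two_iff _ _ _).2 ⟨?_, ?_, ?_⟩, hF⟩ <;>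
    intro m <;> obtain ⟨⟨a, b, c, d⟩, rfl⟩ := ε.surjective m
  · rw [h2, hF, hF]; simp [m1]
  · rw [h3, hF, hF]; simp [m2, m3]
  · rw [h1, hF, hF]; simp [hg, sigma_theta]

lemma fr_proj (h : IsFr V s Q ε) (hs : ∀ v, s (s v) = v) : IsProjective (VCat k 2) Q := by
  refine ⟨fr_vcat h, fun M N π f hM hN hπ hsurj hf => ?_⟩
  obtain ⟨p1, p2, p3⟩ := (isHom_two_iff _ _ _).1 hπ
  obtain ⟨f1, f2, f3⟩ := (isHom_two_iff _ _ _).1 hf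
  obtain ⟨t, ht, ht'⟩ := avg_section M.sigma N.sigma (sigma_sigma M) (sigma_sigma N) π hsurj p3
  obtain ⟨g, hg, hg'⟩ := fr_lift h hM
    (t ∘ₗ f ∘ₗ ε.toLinearMap ∘ₗ LinearMap.inl k V (V × V × V)) (by
      intro v
      have := h.1 v 0 0 0
      simp only [map_zero, neg_zero] at this
      simp only [LinearMap.comp_apply, LinearMap.inl_apply, LinearEquiv.coe_coe]
      rw [← ht', ← f3]
      exact congrArg (fun z => t (f z)) this.symm)
  refine ⟨g, hg, ?_⟩
  ext1 m
  obtain ⟨⟨a, b, c, d⟩, rfl⟩ := ε.surjective m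
  rw [LinearMap.comp_apply, hg', fr_map_expand h hf]
  simp only [map_add, p1, p2, LinearMap.comp_apply, ht]
  rfl

/-- the map into a free module determined by a graded map `g` -/
lemma fr_colift (h : IsFr V s Q ε) {M : GSupMod k (Fin 2)} (hM : VCat k 2 M)
    (g : M.carrier →ₗ[k] V) (hg : ∀ v, g (M.sigma v) = s (g v)) :
    ∃ f : M.carrier →ₗ[k] Q.carrier, IsHom M Q f ∧ ∀ m, f m =
      ε (g (M.θ 0 (M.θ 1 m)), - g (M.θ 1 m), g (M.θ 0 m), g m) := by
  obtain ⟨h1, h2, h3⟩ := h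
  obtain ⟨m1, m2, m3⟩ := (vcat_two_iff M).1 hM
  let F : M.carrier →ₗ[k] (V × V × V × V) :=
    (g ∘ₗ M.θ 0 ∘ₗ M.θ 1).prod ((-(g ∘ₗ M.θ 1)).prod ((g ∘ₗ M.θ 0).prod g))
  have hF : ∀ m, (ε.toLinearMap ∘ₗ F) m =
      ε (g (M.θ 0 (M.θ 1 m)), - g (M.θ 1 m), g (M.θ 0 m), g m) := fun m => rfl
  refine ⟨ε.toLinearMap ∘ₗ F, (isHom_two_iff _ _ _).2 ⟨?_, ?_, ?_⟩, hF⟩ <;> intro m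
  · rw [hF, hF, h2]; simp [m1, m3]
  · rw [hF, hF, h3]; simp [m2]
  · rw [hF, hF, h1]; simp [← hg, sigma_theta]

lemma fr_map_coexpand (h : IsFr V s Q ε) {N : GSupMod k (Fin 2)} {f : N.carrier →ₗ[k] Q.carrier}
    (hf : IsHom N Q f) (m : N.carrier) :
    f m = ε ((ε.symm (f (N.θ 0 (N.θ 1 m)))).2.2.2, - (ε.symm (f (N.θ 1 m))).2.2.2,
      (ε.symm (f (N.θ 0 m))).2.2.2, (ε.symm (f m)).2.2.2) := by
  obtain ⟨h1, h2, h3⟩ := h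
  obtain ⟨f1, f2, f3⟩ := (isHom_two_iff _ _ _).1 hf
  obtain ⟨⟨a, b, c, d⟩, hm⟩ := ε.surjective (f m)
  rw [f1, f2, f1, ← hm, h3, h2, h2]
  simp

lemma fr_inj (h : IsFr V s Q ε) (hs : ∀ v, s (s v) = v) : IsInjective (VCat k 2) Q := by
  refine ⟨fr_vcat h, fun M N j f hM hN hj hinj hf => ?_⟩
  obtain ⟨p1, p2, p3⟩ := (isHom_two_iff _ _ _).1 hj
  obtain ⟨f1, f2, f3⟩ := (isHom_two_iff _ _ _).1 hf
  obtain ⟨t, ht, ht'⟩ := avg_retraction M.sigma N.sigma (sigma_sigma M) (sigma_sigma N) j hinj p3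
  let pr : (V × V × V × V) →ₗ[k] V :=
    LinearMap.snd k V V ∘ₗ LinearMap.snd k V (V × V) ∘ₗ LinearMap.snd k V (V × V × V)
  obtain ⟨g, hg, hg'⟩ := fr_colift h hN (pr ∘ₗ ε.symm.toLinearMap ∘ₗ f ∘ₗ t) (by
      intro v
      simp only [LinearMap.comp_apply]
      rw [ht', f3]
      obtain ⟨⟨a, b, c, d⟩, hm⟩ := ε.surjective (f (t v))
      rw [← hm, h.1]
      simp [pr])
  refine ⟨g, hg, ?_⟩
  ext1 m
  rw [LinearMap.comp_apply, hg', fr_map_coexpand h hf]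
  simp only [← p1, ← p2, LinearMap.comp_apply, ht]
  rfl

lemma fr_exact (h : IsFr V s Q ε) (hs : ∀ v, s (s v) = v) (α β : k) (hab : α ≠ 0 ∨ β ≠ 0)
    (m : Q.carrier) (hm : α • Q.θ 0 m + β • Q.θ 1 m = 0) :
    ∃ u, α • Q.θ 0 u + β • Q.θ 1 u = m := by
  have hw : ![α, β] ≠ 0 := by
    intro h
    have h0 := congrFun h 0
    have h1 := congrFun h 1
    simp at h0 h1
    tauto
  have := proj_exact (fr_proj h hs) ![α, β] hw m (by simpa [actOf] using hm)
  simpa [actOf] using this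

lemma fr_finrank [FiniteDimensional k V] (ε : (V × V × V × V) ≃ₗ[k] Q.carrier) :
    Module.finrank k Q.carrier = 4 * Module.finrank k V := by
  rw [← ε.finrank_eq]; simp; ring
end fr

/-- Nakayama type criterion for a projective cover. -/
lemma projCover_of {P L : GSupMod k (Fin 2)} {π : P.carrier →ₗ[k] L.carrier}
    (hP : IsProjective (VCat k 2) P) (hπ : IsHom P L π) (hs : Function.Surjective π)
    (hk : ∀ p, π p = 0 → ∃ u v, p = P.θ 0 u + P.θ 1 v) : IsProjCover (VCat k 2) P L π := by
  refine ⟨hP, hπ, hs, fun Q f hQ hf hsf => ?_⟩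
  obtain ⟨m1, m2, m3⟩ := (vcat_two_iff P).1 hP.1
  obtain ⟨f1, f2, f3⟩ := (isHom_two_iff _ _ _).1 hf
  have h1 : ∀ p, ∃ q u v, p = f q + P.θ 0 u + P.θ 1 v := by
    intro p
    obtain ⟨q, hq⟩ := hsf (π p)
    obtain ⟨u, v, huv⟩ := hk (p - f q) (by rw [map_sub, sub_eq_zero]; exact hq.symm)
    exact ⟨q, u, v, by rw [add_assoc, ← huv]; abel⟩
  have h2 : ∀ p, ∃ q, P.θ 0 (P.θ 1 p) = f q := by
    intro p
    obtain ⟨q, u, v, rfl⟩ := h1 p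
    exact ⟨Q.θ 0 (Q.θ 1 q), by simp [f1, f2, m1, m2, m3]⟩
  have h3 : ∀ p, ∃ q, P.θ 0 p = f q := by
    intro p
    obtain ⟨q, u, v, rfl⟩ := h1 p
    obtain ⟨q', hq'⟩ := h2 v
    exact ⟨Q.θ 0 q + q', by simp [f1, m1, ← hq']⟩
  have h4 : ∀ p, ∃ q, P.θ 1 p = f q := by
    intro p
    obtain ⟨q, u, v, rfl⟩ := h1 p
    obtain ⟨q', hq'⟩ := h2 u
    exact ⟨Q.θ 1 q - q', by simp [f2, m2, ← hq', m3]⟩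
  intro p
  obtain ⟨q, u, v, rfl⟩ := h1 p
  obtain ⟨q1, hq1⟩ := h3 u
  obtain ⟨q2, hq2⟩ := h4 v
  exact ⟨q + q1 + q2, by simp [hq1, hq2]⟩

/-- Socle criterion for an injective hull. -/
lemma injHull_of {M I : GSupMod k (Fin 2)} {j : M.carrier →ₗ[k] I.carrier}
    (hI : IsInjective (VCat k 2) I) (hj : IsHom M I j) (hi : Function.Injective j)
    (hk : ∀ u, I.θ 0 u = 0 → I.θ 1 u = 0 → ∃ m, j m = u) : IsInjHull (VCat k 2) M I j := by
  refine ⟨hI, hj, hi, fun Q f hQ hf hfj => ?_⟩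
  obtain ⟨m1, m2, m3⟩ := (vcat_two_iff I).1 hI.1
  obtain ⟨f1, f2, f3⟩ := (isHom_two_iff _ _ _).1 hf
  have h0 : ∀ u, f u = 0 → I.θ 0 u = 0 → I.θ 1 u = 0 → u = 0 := by
    intro u hu h1 h2
    obtain ⟨m, rfl⟩ := hk u h1 h2
    have : m = 0 := hfj (by simpa using hu)
    simp [this]
  have h1 : ∀ u, f u = 0 → I.θ 0 (I.θ 1 u) = 0 := by
    intro u hu
    refine h0 _ (by simp [f1, f2, hu]) (by simp [m1]) ?_
    rw [m3, map_neg, m2, neg_zero]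
  have h2 : ∀ u, f u = 0 → I.θ 0 u = 0 := by
    intro u hu
    refine h0 _ (by simp [f1, hu]) (by simp [m1]) ?_
    have := h1 u hu
    rwa [m3, neg_eq_zero] at this
  have h3 : ∀ u, f u = 0 → I.θ 1 u = 0 := by
    intro u hu
    exact h0 _ (by simp [f2, hu]) (h1 u hu) (by simp [m2])
  rw [← LinearMap.ker_eq_bot, eq_bot_iff]
  intro u hu
  exact h0 u hu (h2 u hu) (h3 u hu)

end ranktwo
end SupAux

set_option linter.unusedSectionVars false
namespace SupAux
open SupCat SupCat.GSupMod

section subquot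
variable {k : Type} [Field k] [CharZero k]

lemma exists_sub {R : GSupMod k (Fin 2)} (hR : VCat k 2 R) (W : Submodule k R.carrier)
    (hσ : ∀ w ∈ W, R.sigma w ∈ W) (hx : ∀ w ∈ W, R.θ 0 w ∈ W) (hy : ∀ w ∈ W, R.θ 1 w ∈ W) :
    ∃ (E : GSupMod k (Fin 2)) (i : E.carrier →ₗ[k] R.carrier),
      VCat k 2 E ∧ IsHom E R i ∧ Function.Injective i ∧ LinearMap.range i = W := by
  obtain ⟨m1, m2, m3⟩ := (vcat_two_iff R).1 hR
  obtain ⟨E, e, h1, h2, h3, h4⟩ := exists_mod_two W (R.sigma.restrict hσ) ((R.θ 0).restrict hx)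
    ((R.θ 1).restrict hy)
    (fun u => Subtype.ext (by simp [sigma_sigma]))
    (fun u => Subtype.ext (by simp [sigma_theta]))
    (fun u => Subtype.ext (by simp [sigma_theta]))
    (fun u => Subtype.ext (by simp [m1]))
    (fun u => Subtype.ext (by simp [m2]))
    (fun u => Subtype.ext (by simp [m3]))
  refine ⟨E, W.subtype ∘ₗ e.toLinearMap, h1, (isHom_two_iff _ _ _).2 ⟨?_, ?_, ?_⟩, ?_, ?_⟩
  · intro m; simp [h3]
  · intro m; simp [h4]
  · intro m; simp [h2]
  · intro a b hab
    exact e.injective (Subtype.ext hab)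
  · rw [LinearMap.range_comp, LinearEquiv.range, Submodule.map_top, Submodule.range_subtype]

lemma exists_quot {R : GSupMod k (Fin 2)} (hR : VCat k 2 R) (W : Submodule k R.carrier)
    (hσ : ∀ w ∈ W, R.sigma w ∈ W) (hx : ∀ w ∈ W, R.θ 0 w ∈ W) (hy : ∀ w ∈ W, R.θ 1 w ∈ W) :
    ∃ (E : GSupMod k (Fin 2)) (p : R.carrier →ₗ[k] E.carrier),
      VCat k 2 E ∧ IsHom R E p ∧ Function.Surjective p ∧ LinearMap.ker p = W := by
  obtain ⟨m1, m2, m3⟩ := (vcat_two_iff R).1 hR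
  obtain ⟨E, e, h1, h2, h3, h4⟩ := exists_mod_two (R.carrier ⧸ W) (W.mapQ W R.sigma hσ)
    (W.mapQ W (R.θ 0) hx) (W.mapQ W (R.θ 1) hy)
    (by intro u; obtain ⟨u, rfl⟩ := W.mkQ_surjective u; simp [sigma_sigma])
    (by intro u; obtain ⟨u, rfl⟩ := W.mkQ_surjective u; simp [sigma_theta])
    (by intro u; obtain ⟨u, rfl⟩ := W.mkQ_surjective u; simp [sigma_theta])
    (by intro u; obtain ⟨u, rfl⟩ := W.mkQ_surjective u; simp [m1])
    (by intro u; obtain ⟨u, rfl⟩ := W.mkQ_surjective u; simp [m2])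
    (by intro u; obtain ⟨u, rfl⟩ := W.mkQ_surjective u; simp [m3])
  refine ⟨E, e.symm.toLinearMap ∘ₗ W.mkQ, h1, (isHom_two_iff _ _ _).2 ⟨?_, ?_, ?_⟩, ?_, ?_⟩
  · intro m; apply e.injective; simp [h3]
  · intro m; apply e.injective; simp [h4]
  · intro m; apply e.injective; simp [h2]
  · exact e.symm.surjective.comp W.mkQ_surjective
  · rw [LinearEquiv.ker_comp, Submodule.ker_mkQ]

/-- the condition on the kernels of all nonzero combinations of two operators -/
def CH {U : Type} [AddCommGroup U] [Module k U] (X Y : U →ₗ[k] U) : Prop :=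
  ∀ α β : k, (α ≠ 0 ∨ β ≠ 0) →
    2 * Module.finrank k (LinearMap.ker (α • X + β • Y)) = Module.finrank k U + 1

section exact
variable {A P B : Type} [AddCommGroup A] [Module k A] [AddCommGroup P] [Module k P]
  [AddCommGroup B] [Module k B] [FiniteDimensional k A] [FiniteDimensional k P]
  [FiniteDimensional k B]

lemma exact_ker (i : A →ₗ[k] P) (p : P →ₗ[k] B) (hi : Function.Injective i)
    (hp : Function.Surjective p) (hip : LinearMap.range i = LinearMap.ker p)
    (a : A →ₗ[k] A) (z : P →ₗ[k] P) (b : B →ₗ[k] B)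
    (hia : ∀ u, i (a u) = z (i u)) (hpb : ∀ u, p (z u) = b (p u))
    (hzz : ∀ u, z (z u) = 0) (hz : ∀ u, z u = 0 → ∃ v, z v = u) :
    2 * Module.finrank k (LinearMap.ker a) + Module.finrank k B =
      Module.finrank k A + 2 * Module.finrank k (LinearMap.ker b) := by
  have e1 : ∀ u, p (i u) = 0 := fun u => by
    have : i u ∈ LinearMap.ker p := hip ▸ LinearMap.mem_range_self i u
    exact this
  have e2 : ∀ u, p u = 0 → ∃ v, i v = u := fun u hu => by
    have : u ∈ LinearMap.range i := hip ▸ hu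
    exact this
  -- the preimage of `ker b`
  let W := LinearMap.ker (b ∘ₗ p)
  have d1 := LinearMap.finrank_range_add_finrank_ker (p.domRestrict W)
  have d2 := LinearMap.finrank_range_add_finrank_ker (z.domRestrict W)
  have d3 := LinearMap.finrank_range_add_finrank_ker z
  have d4 := LinearMap.finrank_range_add_finrank_ker p
  have d5 : LinearMap.range z = LinearMap.ker z := by
    apply le_antisymm
    · rintro _ ⟨u, rfl⟩; exact hzz u
    · intro u hu; exact hz u hu
  rw [d5] at d3
  rw [LinearMap.range_eq_top.2 hp, finrank_top, ← hip, LinearMap.finrank_range_of_inj hi] at d4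
  have r1 : LinearMap.range (p.domRestrict W) = LinearMap.ker b := by
    ext u
    constructor
    · rintro ⟨⟨w, hw⟩, rfl⟩; exact hw
    · intro hu
      obtain ⟨w, rfl⟩ := hp u
      exact ⟨⟨w, hu⟩, rfl⟩
  have r2 : LinearMap.range (z.domRestrict W) = (LinearMap.ker a).map i := by
    ext u
    constructor
    · rintro ⟨⟨w, hw⟩, rfl⟩
      have hw' : b (p w) = 0 := hw
      obtain ⟨v, hv⟩ := e2 (z w) (by rw [hpb, hw'])
      refine ⟨v, ?_, hv⟩
      apply hi
      rw [hia, hv, hzz, map_zero]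
    · rintro ⟨v, hv, rfl⟩
      have hv' : a v = 0 := hv
      obtain ⟨w, hw⟩ := hz (i v) (by rw [← hia, hv', map_zero])
      exact ⟨⟨w, by simp [W, ← hpb, hw, e1]⟩, hw⟩
  have k1 : Module.finrank k (LinearMap.ker (p.domRestrict W)) = Module.finrank k A := by
    rw [← LinearMap.finrank_range_of_inj hi, hip]
    refine LinearEquiv.finrank_eq (LinearEquiv.ofBijective
      ((W.subtype ∘ₗ (LinearMap.ker (p.domRestrict W)).subtype).codRestrict (LinearMap.ker p)
        (fun u => u.2)) ⟨?_, ?_⟩)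
    · intro u v h
      exact Subtype.ext (Subtype.ext (congrArg (fun t : LinearMap.ker p => (t : P)) h))
    · rintro ⟨u, hu⟩
      have hu' : p u = 0 := hu
      exact ⟨⟨⟨u, by simp [W, hu']⟩, hu⟩, rfl⟩
  have k2 : Module.finrank k (LinearMap.ker (z.domRestrict W)) =
      Module.finrank k (LinearMap.ker z) := by
    refine LinearEquiv.finrank_eq (LinearEquiv.ofBijective
      ((W.subtype ∘ₗ (LinearMap.ker (z.domRestrict W)).subtype).codRestrict (LinearMap.ker z)
        (fun u => u.2)) ⟨?_, ?_⟩)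
    · intro u v h
      exact Subtype.ext (Subtype.ext (congrArg (fun t : LinearMap.ker z => (t : P)) h))
    · rintro ⟨u, hu⟩
      have hu' : z u = 0 := hu
      exact ⟨⟨⟨u, by simp [W, ← hpb, hu']⟩, hu⟩, rfl⟩
  rw [r1, k1] at d1
  rw [r2, k2, ← LinearEquiv.finrank_eq (Submodule.equivMapOfInjective i hi _)] at d2
  omega

lemma ch_exact (i : A →ₗ[k] P) (p : P →ₗ[k] B) (hi : Function.Injective i)
    (hp : Function.Surjective p) (hip : LinearMap.range i = LinearMap.ker p)
    (a a' : A →ₗ[k] A) (z z' : P →ₗ[k] P) (b b' : B →ₗ[k] B)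
    (hia : ∀ u, i (a u) = z (i u)) (hia' : ∀ u, i (a' u) = z' (i u))
    (hpb : ∀ u, p (z u) = b (p u)) (hpb' : ∀ u, p (z' u) = b' (p u))
    (h1 : ∀ u, z (z u) = 0) (h2 : ∀ u, z' (z' u) = 0) (h3 : ∀ u, z (z' u) = - z' (z u))
    (hz : ∀ α β : k, (α ≠ 0 ∨ β ≠ 0) → ∀ u, α • z u + β • z' u = 0 →
      ∃ v, α • z v + β • z' v = u) : CH a a' ↔ CH b b' := by
  have key : ∀ α β : k, (α ≠ 0 ∨ β ≠ 0) →
      2 * Module.finrank k (LinearMap.ker (α • a + β • a')) + Module.finrank k B =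
      Module.finrank k A + 2 * Module.finrank k (LinearMap.ker (α • b + β • b')) := by
    intro α β hab
    refine exact_ker i p hi hp hip _ (α • z + β • z') _ (by simp [hia, hia'])
      (by simp [hpb, hpb']) ?_ (by simpa using hz α β hab)
    intro u
    simp [h1, h2, h3, smul_smul, mul_comm]
  constructor
  · intro h α β hab
    have := h α β hab
    have := key α β hab
    omega
  · intro h α β hab
    have := h α β hab
    have := key α β hab
    omega

/-- sign of a parity -/
def sg (k : Type) [Field k] (p : Bool) : k := if p then -1 else 1

lemma sg_not (p : Bool) : sg k (!p) = - sg k p := by cases p <;> simp [sg]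
lemma sg_mul (p : Bool) : sg k p * sg k p = 1 := by cases p <;> simp [sg]

/-- the homology of `y` is nonzero in parity `p` -/
def HasPar {U : Type} [AddCommGroup U] [Module k U] (σ y : U →ₗ[k] U) (p : Bool) : Prop :=
  ∃ z, σ z = sg k p • z ∧ y z = 0 ∧ ∀ u, y u ≠ z

lemma par_exact_right (i : A →ₗ[k] P) (p : P →ₗ[k] B) (hi : Function.Injective i)
    (hp : Function.Surjective p) (hip : LinearMap.range i = LinearMap.ker p)
    (a σa : A →ₗ[k] A) (z σ : P →ₗ[k] P) (b σb : B →ₗ[k] B)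
    (hia : ∀ u, i (a u) = z (i u)) (hia' : ∀ u, i (σa u) = σ (i u))
    (hpb : ∀ u, p (z u) = b (p u)) (hpb' : ∀ u, p (σ u) = σb (p u))
    (hσ : ∀ u, σ (σ u) = u) (hσz : ∀ u, σ (z u) = - z (σ u))
    (hzz : ∀ u, z (z u) = 0) (hz : ∀ u, z u = 0 → ∃ v, z v = u) (q : Bool)
    (h : HasPar σa a q) : HasPar σb b (!q) := by
  have e1 : ∀ u, p (i u) = 0 := fun u => by
    have : i u ∈ LinearMap.ker p := hip ▸ LinearMap.mem_range_self i u
    exact this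
  have e2 : ∀ u, p u = 0 → ∃ v, i v = u := fun u hu => by
    have : u ∈ LinearMap.range i := hip ▸ hu
    exact this
  obtain ⟨t, ht1, ht2, ht3⟩ := h
  obtain ⟨u, hu⟩ := hz (i t) (by rw [← hia, ht2, map_zero])
  have hσu : z (σ u) = - (sg k q • i t) := by
    rw [← map_smul, ← ht1, hia', ← hu, hσz, neg_neg]
  let u' := (2⁻¹ : k) • (u - sg k q • σ u)
  have hu' : z u' = i t := by
    simp only [u', map_smul, map_sub, hu, hσu, smul_neg, smul_smul, sg_mul, one_smul,
      sub_neg_eq_add, half_add]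
  have hs : σ u' = - (sg k q • u') := by
    simp only [u', map_smul, map_sub, hσ, smul_sub, smul_smul, mul_left_comm (sg k q), sg_mul]
    module
  refine ⟨p u', ?_, ?_, ?_⟩
  · rw [← hpb', hs, sg_not]; simp
  · rw [← hpb, hu', e1]
  · intro w hw
    obtain ⟨w, rfl⟩ := hp w
    obtain ⟨e, he⟩ := e2 (u' - z w) (by rw [map_sub, hpb, hw, sub_self])
    apply ht3 e
    apply hi
    rw [hia, he, map_sub, hzz, hu', sub_zero]

lemma par_exact_left (i : A →ₗ[k] P) (p : P →ₗ[k] B) (hi : Function.Injective i)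
    (hp : Function.Surjective p) (hip : LinearMap.range i = LinearMap.ker p)
    (a σa : A →ₗ[k] A) (z σ : P →ₗ[k] P) (b σb : B →ₗ[k] B)
    (hia : ∀ u, i (a u) = z (i u)) (hia' : ∀ u, i (σa u) = σ (i u))
    (hpb : ∀ u, p (z u) = b (p u)) (hpb' : ∀ u, p (σ u) = σb (p u))
    (hσ : ∀ u, σ (σ u) = u) (hσz : ∀ u, σ (z u) = - z (σ u))
    (hzz : ∀ u, z (z u) = 0) (hz : ∀ u, z u = 0 → ∃ v, z v = u) (q : Bool)
    (h : HasPar σb b q) : HasPar σa a (!q) := by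
  have e2 : ∀ u, p u = 0 → ∃ v, i v = u := fun u hu => by
    have : u ∈ LinearMap.range i := hip ▸ hu
    exact this
  have e1 : ∀ u, p (i u) = 0 := fun u => by
    have : i u ∈ LinearMap.ker p := hip ▸ LinearMap.mem_range_self i u
    exact this
  obtain ⟨t, ht1, ht2, ht3⟩ := h
  obtain ⟨u, hu⟩ := hp t
  let u' := (2⁻¹ : k) • (u + sg k q • σ u)
  have hu' : p u' = t := by
    simp only [u', map_smul, map_add, hu, hpb', ht1, smul_smul, sg_mul, one_smul, half_add]
  have hs : σ u' = sg k q • u' := by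
    simp only [u', map_smul, map_add, hσ, smul_add, smul_smul, mul_left_comm (sg k q), sg_mul]
    module
  obtain ⟨l, hl⟩ := e2 (z u') (by rw [hpb, hu', ht2])
  refine ⟨l, ?_, ?_, ?_⟩
  · apply hi
    rw [hia', hl, hσz, hs, sg_not, map_smul z, map_smul i, hl, neg_smul]
  · apply hi
    rw [hia, hl, hzz, map_zero]
  · intro w hw
    obtain ⟨v, hv⟩ := hz (u' - i w) (by rw [map_sub, ← hia, hw, hl, sub_self])
    apply ht3 (p v)
    rw [← hpb, hv, map_sub, e1, hu', sub_zero]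

end exact
end subquot
end SupAux

set_option linter.unusedSectionVars false
namespace SupAux
open SupCat SupCat.GSupMod

section decomp
variable {k : Type} [Field k] [CharZero k]

lemma decomp {R : GSupMod k (Fin 2)} (hR : VCat k 2 R) :
    ∃ (E Q : GSupMod k (Fin 2)) (V : Submodule k R.carrier) (s : V →ₗ[k] V)
      (ε : (V × V × V × V) ≃ₗ[k] Q.carrier) (φ : R.carrier ≃ₗ[k] E.carrier × Q.carrier),
      VCat k 2 E ∧ (∀ e, E.θ 0 (E.θ 1 e) = 0) ∧ (∀ v, s (s v) = v) ∧ IsFr V s Q ε ∧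
      (∀ r, φ (R.sigma r) = (E.sigma (φ r).1, Q.sigma (φ r).2)) ∧
      (∀ i r, φ (R.θ i r) = (E.θ i (φ r).1, Q.θ i (φ r).2)) := by
  obtain ⟨m1, m2, m3⟩ := (vcat_two_iff R).1 hR
  let K := LinearMap.ker (R.θ 0 ∘ₗ R.θ 1)
  have hK : ∀ w ∈ K, R.sigma w ∈ K := by
    intro w hw
    have hw' : R.θ 0 (R.θ 1 w) = 0 := hw
    have : R.sigma (R.θ 0 (R.θ 1 w)) = 0 := by rw [hw', map_zero]
    rw [sigma_theta, sigma_theta, map_neg, neg_neg] at this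
    exact this
  obtain ⟨t, ht, ht'⟩ := avg_retraction (R.sigma.restrict hK) R.sigma
    (fun u => Subtype.ext (by simp [sigma_sigma])) (sigma_sigma R) K.subtype K.injective_subtype
    (fun a => rfl)
  let V := LinearMap.ker t
  have hV : ∀ w ∈ V, R.sigma w ∈ V := by
    intro w hw
    have hw' : t w = 0 := hw
    show t (R.sigma w) = 0
    rw [ht', hw', map_zero]
  have hVK : ∀ v : V, R.θ 0 (R.θ 1 v) = 0 → v = 0 := by
    rintro ⟨v, hv⟩ h
    have h1 := ht ⟨v, h⟩
    have h2 : t v = 0 := hv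
    simp only [Submodule.subtype_apply] at h1
    rw [h2] at h1
    exact Subtype.ext (congrArg Subtype.val h1).symm
  let s := R.sigma.restrict hV
  have hs : ∀ v, s (s v) = v := fun u => Subtype.ext (by simp [s, sigma_sigma])
  obtain ⟨Q, ε, hQ⟩ := fr_exists hs
  obtain ⟨f, hf, hf'⟩ := fr_lift hQ hR V.subtype (fun v => rfl)
  simp only [Submodule.subtype_apply] at hf'
  have hfi : Function.Injective f := by
    rw [← LinearMap.ker_eq_bot, eq_bot_iff]
    intro q hq
    obtain ⟨⟨a, b, c, d⟩, rfl⟩ := ε.surjective q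
    have hq : f (ε (a, b, c, d)) = 0 := hq
    rw [hf'] at hq
    have ha : a = 0 := by
      apply hVK
      have := congrArg (fun z => R.θ 0 (R.θ 1 z)) hq
      simpa [m1, m2, m3] using this
    subst ha
    have hb : b = 0 := by
      apply hVK
      have := congrArg (fun z => R.θ 1 z) hq
      simpa [m1, m2, m3] using this
    subst hb
    have hc : c = 0 := by
      apply hVK
      have := congrArg (fun z => R.θ 0 z) hq
      simpa [m1, m2, m3] using this
    subst hc
    have hd : d = 0 := by
      apply hVK
      simpa using hq
    subst hd
    exact map_zero ε
  obtain ⟨f1, f2, f3⟩ := (isHom_two_iff _ _ _).1 hf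
  obtain ⟨h, hh, hh'⟩ := (fr_inj hQ hs).2 Q R f LinearMap.id (fr_vcat hQ) hR hf hfi
    ((isHom_two_iff _ _ _).2 ⟨fun _ => rfl, fun _ => rfl, fun _ => rfl⟩)
  have hhf : ∀ q, h (f q) = q := LinearMap.congr_fun hh'
  obtain ⟨h1, h2, h3⟩ := (isHom_two_iff _ _ _).1 hh
  obtain ⟨E, i, hE, hi, hii, hir⟩ := exists_sub hR (LinearMap.ker h)
    (fun w hw => by have hw' : h w = 0 := hw
                    simp [h3, hw'])
    (fun w hw => by have hw' : h w = 0 := hw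
                    simp [h1, hw'])
    (fun w hw => by have hw' : h w = 0 := hw
                    simp [h2, hw'])
  obtain ⟨i1, i2, i3⟩ := (isHom_two_iff _ _ _).1 hi
  have hhi : ∀ e, h (i e) = 0 := fun e => by
    have : i e ∈ LinearMap.ker h := hir ▸ LinearMap.mem_range_self i e
    exact this
  let ψ : (E.carrier × Q.carrier) ≃ₗ[k] R.carrier := LinearEquiv.ofBijective (i.coprod f) (by
    constructor
    · rw [← LinearMap.ker_eq_bot, eq_bot_iff]
      rintro ⟨e, q⟩ heq
      have heq : i e + f q = 0 := heq
      have hq : q = 0 := by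
        have := congrArg h heq
        simpa [hhi, hhf] using this
      subst hq
      have he : e = 0 := hii (by simpa using heq)
      subst he
      rfl
    · intro r
      have : r - f (h r) ∈ LinearMap.range i := by
        rw [hir]; simp [hhf]
      obtain ⟨e, he⟩ := this
      exact ⟨(e, h r), by simp [he]⟩)
  have hψ : ∀ e q, ψ (e, q) = i e + f q := fun e q => rfl
  refine ⟨E, Q, V, s, ε, ψ.symm, hE, ?_, hs, hQ, ?_, ?_⟩
  · intro e
    apply hii
    rw [map_zero, i1, i2]
    have hv : i e - t (i e) ∈ V := by
      show t _ = 0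
      rw [map_sub, sub_eq_zero]
      exact (ht _).symm
    have hxy : R.θ 0 (R.θ 1 (i e)) = f (ε (0, 0, 0, ⟨_, hv⟩)) := by
      have := (t (i e)).2
      have this : R.θ 0 (R.θ 1 (t (i e))) = 0 := this
      rw [hf']
      simp [this]
    have h4 := hhf (ε (0, 0, 0, ⟨_, hv⟩))
    rw [← hxy, h1, h2, hhi, map_zero, map_zero] at h4
    rw [hxy, ← h4, map_zero]
  · intro r
    obtain ⟨⟨e, q⟩, rfl⟩ := ψ.surjective r
    rw [LinearEquiv.symm_apply_eq, LinearEquiv.symm_apply_apply, hψ, hψ, i3, f3, map_add]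
  · intro j r
    obtain ⟨⟨e, q⟩, rfl⟩ := ψ.surjective r
    rw [LinearEquiv.symm_apply_eq, LinearEquiv.symm_apply_apply, hψ, hψ, map_add]
    have hi' := ((isHom_iff _ _ _).1 hi).1 j e
    have hf' := ((isHom_iff _ _ _).1 hf).1 j q
    rw [hi', hf']

end decomp
end SupAux

set_option linter.unusedSectionVars false
namespace SupAux
open SupCat SupCat.GSupMod

section linalg
variable {k : Type} [Field k]
variable {U W U' W' : Type} [AddCommGroup U] [Module k U] [FiniteDimensional k U]
  [AddCommGroup W] [Module k W] [FiniteDimensional k W]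
  [AddCommGroup U'] [Module k U'] [FiniteDimensional k U']
  [AddCommGroup W'] [Module k W'] [FiniteDimensional k W']

def rkk (f : U →ₗ[k] W) : ℕ := Module.finrank k (LinearMap.range f)

lemma rkk_conj (e₁ : U ≃ₗ[k] U') (e₂ : W ≃ₗ[k] W') (f : U →ₗ[k] W) (f' : U' →ₗ[k] W')
    (h : ∀ u, e₂ (f u) = f' (e₁ u)) : rkk f = rkk f' := by
  have h1 : e₂.toLinearMap ∘ₗ f = f' ∘ₗ e₁.toLinearMap := LinearMap.ext h
  have h2 : LinearMap.range (f' ∘ₗ e₁.toLinearMap) = LinearMap.range f' := by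
    rw [LinearMap.range_comp, LinearEquiv.range, LinearMap.range_eq_map]
  unfold rkk
  rw [← h2, ← h1, LinearMap.range_comp]
  exact LinearEquiv.finrank_eq (Submodule.equivMapOfInjective _ e₂.injective _)

lemma rkk_prod (f : U →ₗ[k] W) (g : U' →ₗ[k] W') : rkk (f.prodMap g) = rkk f + rkk g := by
  have a := LinearMap.finrank_range_add_finrank_ker (f.prodMap g)
  have b := LinearMap.finrank_range_add_finrank_ker f
  have c := LinearMap.finrank_range_add_finrank_ker g
  have d : Module.finrank k (LinearMap.ker (f.prodMap g)) =
      Module.finrank k (LinearMap.ker f) + Module.finrank k (LinearMap.ker g) := by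
    rw [← Module.finrank_prod, LinearMap.ker_prodMap]
    exact LinearEquiv.finrank_eq
      { toFun := fun u => (⟨u.1.1, u.2.1⟩, ⟨u.1.2, u.2.2⟩)
        invFun := fun u => ⟨(u.1.1, u.2.1), ⟨u.1.2, u.2.2⟩⟩
        map_add' := fun _ _ => rfl
        map_smul' := fun _ _ => rfl
        left_inv := fun _ => rfl
        right_inv := fun _ => rfl }
  rw [Module.finrank_prod] at a
  unfold rkk
  omega

lemma ch_iff (X Y : U →ₗ[k] U) : CH X Y ↔ ∀ α β : k, (α ≠ 0 ∨ β ≠ 0) →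
    2 * rkk (α • X + β • Y) + 1 = Module.finrank k U := by
  unfold CH rkk
  refine forall_congr' fun α => forall_congr' fun β => forall_congr' fun hab => ?_
  have := LinearMap.finrank_range_add_finrank_ker (α • X + β • Y)
  omega

/-- eigenvalue lemma -/
lemma ev_lemma [IsAlgClosed k] [Nontrivial U] (X Y : U →ₗ[k] W)
    (h : LinearMap.range X ≤ LinearMap.range Y) :
    ∃ α β : k, (α ≠ 0 ∨ β ≠ 0) ∧ ∃ u, u ≠ 0 ∧ α • X u + β • Y u = 0 := by
  by_cases hY : Function.Injective Y
  · let e := LinearEquiv.ofInjective Y hY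
    let T : Module.End k U := e.symm.toLinearMap ∘ₗ X.codRestrict (LinearMap.range Y)
      (fun u => h ⟨u, rfl⟩)
    have hT : ∀ u, Y (T u) = X u := by
      intro u
      have := e.apply_symm_apply (X.codRestrict (LinearMap.range Y) (fun u => h ⟨u, rfl⟩) u)
      exact congrArg Subtype.val this
    obtain ⟨c, hc⟩ := Module.End.exists_eigenvalue T
    obtain ⟨u, hu⟩ := hc.exists_hasEigenvector
    refine ⟨1, -c, Or.inl one_ne_zero, u, hu.2, ?_⟩
    rw [← hT, hu.apply_eq_smul]
    simp
  · rw [← LinearMap.ker_eq_bot, Submodule.eq_bot_iff] at hY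
    push Not at hY
    obtain ⟨u, hu, hu0⟩ := hY
    exact ⟨0, 1, Or.inr one_ne_zero, u, hu0, by simpa using hu⟩

lemma kron [IsAlgClosed k] (X Y : U →ₗ[k] W)
    (hinj : ∀ α β : k, (α ≠ 0 ∨ β ≠ 0) → ∀ u, α • X u + β • Y u = 0 → u = 0)
    (N : ℕ) (hN : Module.finrank k U ≤ N) (t : ℕ → U)
    (ht : ∀ i < N, X (t i) + Y (t (i + 1)) = 0) : ∀ i ≤ N, t i = 0 := by
  let S : ℕ → Submodule k U := fun j => Submodule.span k (t '' {i | i < j})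
  have hmono : ∀ j, S j ≤ S (j + 1) := fun j => Submodule.span_mono
    (Set.image_mono (fun i (hi : i < j) => (by show i < j + 1; omega)))
  have hmem : ∀ i j, i < j → t i ∈ S j := fun i j hij =>
    Submodule.subset_span ⟨i, hij, rfl⟩
  have hex : ∃ j ≤ N, t j ∈ S j := by
    by_contra! hcon
    have : ∀ j ≤ N + 1, j ≤ Module.finrank k (S j) := by
      intro j
      induction j with
      | zero => simp
      | succ j ih =>
        intro hj
        have h1 := ih (by omega)
        have h2 : S j < S (j + 1) := by
          refine lt_of_le_of_ne (hmono j) (fun he => hcon j (by omega) ?_)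
          rw [he]
          exact hmem j (j + 1) (by omega)
        have := Submodule.finrank_lt_finrank_of_lt h2
        omega
    have h1 := this (N + 1) le_rfl
    have h2 := Submodule.finrank_le (S (N + 1))
    omega
  obtain ⟨j, hj, hjS⟩ := hex
  have hS : S j = ⊥ := by
    by_contra hne
    have : Nontrivial (S j) := Submodule.nontrivial_iff_ne_bot.2 hne
    obtain ⟨α, β, hab, u, hu, huv⟩ := ev_lemma (X ∘ₗ (S j).subtype) (Y ∘ₗ (S j).subtype) (by
      rw [LinearMap.range_comp, LinearMap.range_comp, Submodule.range_subtype]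
      show Submodule.map X (Submodule.span k _) ≤ _
      rw [Submodule.map_span, Submodule.span_le]
      rintro _ ⟨_, ⟨i, hi, rfl⟩, rfl⟩
      have hi : i < j := hi
      have hmem' : t (i + 1) ∈ S j := by
        rcases Nat.lt_or_ge (i + 1) j with h | h
        · exact hmem _ _ h
        · have : i + 1 = j := by omega
          rw [this]; exact hjS
      refine ⟨- t (i + 1), neg_mem hmem', ?_⟩
      rw [map_neg, eq_comm, eq_neg_iff_add_eq_zero]
      exact ht i (by omega))
    exact hu (Subtype.ext (hinj α β hab u huv))
  have h0 : t 0 = 0 := by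
    rcases Nat.eq_zero_or_pos j with h | h
    · subst h
      rw [hS] at hjS
      simpa using hjS
    · have := hmem 0 j h
      rw [hS] at this
      simpa using this
  intro i
  induction i with
  | zero => intro _; exact h0
  | succ i ih =>
    intro hi
    have h1 := ht i (by omega)
    rw [ih (by omega), map_zero, zero_add] at h1
    exact hinj 0 1 (Or.inr one_ne_zero) _ (by simpa using h1)

end linalg
end SupAux

set_option linter.unusedSectionVars false
namespace SupAux
open SupCat SupCat.GSupMod

section types
variable {k : Type} [Field k]
variable {U : Type} [AddCommGroup U] [Module k U] [FiniteDimensional k U]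

/-- `X,Y` are operators with vanishing products and constant homology dimension one. -/
structure Knd (X Y : U →ₗ[k] U) (n : ℕ) : Prop where
  xx : ∀ u, X (X u) = 0
  yy : ∀ u, Y (Y u) = 0
  xy : ∀ u, X (Y u) = 0
  yx : ∀ u, Y (X u) = 0
  ch : CH X Y
  dim : Module.finrank k U = 2 * n + 1

def TypP (X Y : U →ₗ[k] U) : Prop := ∀ u, ∃ w, X w = Y u
def TypM (X Y : U →ₗ[k] U) : Prop := ∀ u, X u = 0 → Y u = 0

variable {X Y : U →ₗ[k] U} {n : ℕ}

lemma Knd.ker_dim (h : Knd X Y n) (α β : k) (hab : α ≠ 0 ∨ β ≠ 0) :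
    Module.finrank k (LinearMap.ker (α • X + β • Y)) = n + 1 := by
  have := h.ch α β hab
  have := h.dim
  omega

lemma Knd.rk_dim (h : Knd X Y n) (α β : k) (hab : α ≠ 0 ∨ β ≠ 0) :
    Module.finrank k (LinearMap.range (α • X + β • Y)) = n := by
  have := h.ker_dim α β hab
  have := h.dim
  have := LinearMap.finrank_range_add_finrank_ker (α • X + β • Y)
  omega

lemma Knd.kerX (h : Knd X Y n) : Module.finrank k (LinearMap.ker X) = n + 1 := by
  have := h.ker_dim 1 0 (by simp)
  rwa [show (1 : k) • X + (0 : k) • Y = X by simp] at this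
lemma Knd.kerY (h : Knd X Y n) : Module.finrank k (LinearMap.ker Y) = n + 1 := by
  have := h.ker_dim 0 1 (by simp)
  rwa [show (0 : k) • X + (1 : k) • Y = Y by simp] at this
lemma Knd.rkX (h : Knd X Y n) : Module.finrank k (LinearMap.range X) = n := by
  have := h.rk_dim 1 0 (by simp)
  rwa [show (1 : k) • X + (0 : k) • Y = X by simp] at this
lemma Knd.rkY (h : Knd X Y n) : Module.finrank k (LinearMap.range Y) = n := by
  have := h.rk_dim 0 1 (by simp)
  rwa [show (0 : k) • X + (1 : k) • Y = Y by simp] at this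

lemma Knd.BC (h : Knd X Y n) :
    LinearMap.range X ⊔ LinearMap.range Y ≤ LinearMap.ker X ⊓ LinearMap.ker Y := by
  rw [sup_le_iff, le_inf_iff, le_inf_iff]
  refine ⟨⟨?_, ?_⟩, ?_, ?_⟩ <;> rintro _ ⟨u, rfl⟩
  · exact h.xx u
  · exact h.yx u
  · exact h.xy u
  · exact h.yy u

lemma Knd.dich (h : Knd X Y n) : TypP X Y ∨ TypM X Y := by
  by_cases hB : LinearMap.range X = LinearMap.range X ⊔ LinearMap.range Y
  · left
    intro u
    have : Y u ∈ LinearMap.range X := by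
      rw [hB]; exact Submodule.mem_sup_right ⟨u, rfl⟩
    exact this
  · right
    have h1 := Submodule.finrank_lt_finrank_of_lt
      (lt_of_le_of_ne (le_sup_left : LinearMap.range X ≤ LinearMap.range X ⊔ LinearMap.range Y) hB)
    have h2 := Submodule.finrank_mono h.BC
    have h3 : LinearMap.ker X ⊓ LinearMap.ker Y = LinearMap.ker X := by
      apply Submodule.eq_of_le_of_finrank_le inf_le_left
      rw [h.kerX]
      rw [h.rkX] at h1
      omega
    intro u hu
    have : u ∈ LinearMap.ker X ⊓ LinearMap.ker Y := by rw [h3]; exact hu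
    exact this.2

lemma Knd.typM_ker (h : Knd X Y n) (hm : TypM X Y) (α β : k) (hab : α ≠ 0 ∨ β ≠ 0) (u : U)
    (hu : α • X u + β • Y u = 0) : X u = 0 := by
  have hle : LinearMap.ker X ≤ LinearMap.ker (α • X + β • Y) := by
    intro w hw
    have hw : X w = 0 := hw
    simp [hw, hm w hw]
  have := Submodule.eq_of_le_of_finrank_le hle (by rw [h.ker_dim α β hab, h.kerX])
  have h2 : u ∈ LinearMap.ker X := by rw [this]; simpa using hu
  exact h2

lemma Knd.typP_range (h : Knd X Y n) (hp : TypP X Y) (α β : k) (hab : α ≠ 0 ∨ β ≠ 0) (u : U) :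
    ∃ w, α • X w + β • Y w = X u := by
  have hle : LinearMap.range (α • X + β • Y) ≤ LinearMap.range X := by
    rintro _ ⟨w, rfl⟩
    obtain ⟨w', hw'⟩ := hp w
    exact ⟨α • w + β • w', by simp [hw']⟩
  have := Submodule.eq_of_le_of_finrank_le hle (by rw [h.rk_dim α β hab, h.rkX])
  have h2 : X u ∈ LinearMap.range (α • X + β • Y) := by rw [this]; exact ⟨u, rfl⟩
  simpa using h2

lemma Knd.not_both [IsAlgClosed k] (h : Knd X Y n) (hn : 1 ≤ n) (hp : TypP X Y)
    (hm : TypM X Y) : False := by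
  let K := LinearMap.ker X
  have hKY : K ≤ LinearMap.ker Y := fun u hu => hm u hu
  have : Nontrivial (U ⧸ K) := by
    apply Submodule.Quotient.nontrivial_iff.2
    intro hK
    have h1 := h.kerX
    have h2 : Module.finrank k K = n + 1 := h1
    rw [hK, finrank_top, h.dim] at h2
    omega
  obtain ⟨α, β, hab, u, hu, huv⟩ := ev_lemma (K.liftQ Y hKY) (K.liftQ X le_rfl) (by
    rw [Submodule.range_liftQ, Submodule.range_liftQ]
    rintro _ ⟨u, rfl⟩
    exact hp u)
  obtain ⟨u, rfl⟩ := K.mkQ_surjective u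
  apply hu
  simp only [Submodule.mkQ_apply, Submodule.liftQ_apply] at huv
  have := h.typM_ker hm β α hab.symm u (by rw [add_comm]; exact huv)
  exact (Submodule.Quotient.mk_eq_zero K).2 this

lemma Knd.typP_soc [IsAlgClosed k] (h : Knd X Y n) (hn : 1 ≤ n) (hp : TypP X Y) (u : U)
    (h1 : X u = 0) (h2 : Y u = 0) : ∃ w, X w = u := by
  have hne : LinearMap.ker X ⊓ LinearMap.ker Y ≠ LinearMap.ker X := by
    intro he
    refine h.not_both hn hp (fun u hu => ?_)
    have : u ∈ LinearMap.ker X ⊓ LinearMap.ker Y := by rw [he]; exact hu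
    exact this.2
  have h3 := Submodule.finrank_lt_finrank_of_lt (lt_of_le_of_ne inf_le_left hne)
  have h4 : LinearMap.range X = LinearMap.ker X ⊓ LinearMap.ker Y := by
    apply Submodule.eq_of_le_of_finrank_le (le_sup_left.trans h.BC)
    rw [h.rkX]
    rw [h.kerX] at h3
    omega
  have : u ∈ LinearMap.range X := by rw [h4]; exact ⟨h1, h2⟩
  exact this

lemma Knd.typM_rad [IsAlgClosed k] (h : Knd X Y n) (hn : 1 ≤ n) (hm : TypM X Y) (u : U)
    (h1 : X u = 0) : u ∈ LinearMap.range X ⊔ LinearMap.range Y := by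
  have hne : LinearMap.range X ≠ LinearMap.range X ⊔ LinearMap.range Y := by
    intro he
    refine h.not_both hn (fun u => ?_) hm
    have : Y u ∈ LinearMap.range X := by
      rw [he]; exact Submodule.mem_sup_right ⟨u, rfl⟩
    exact this
  have h3 := Submodule.finrank_lt_finrank_of_lt (lt_of_le_of_ne le_sup_left hne)
  have h4 : LinearMap.range X ⊔ LinearMap.range Y = LinearMap.ker X := by
    apply Submodule.eq_of_le_of_finrank_le (h.BC.trans inf_le_left)
    rw [h.kerX]
    rw [h.rkX] at h3
    omega
  rw [h4]
  exact h1

end types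
end SupAux

set_option linter.unusedSectionVars false
namespace SupAux
open SupCat SupCat.GSupMod

section steps
variable {k : Type} [Field k] [CharZero k]

lemma Knd.vcat {E : GSupMod k (Fin 2)} {n : ℕ} (h : Knd (E.θ 0) (E.θ 1) n) : VCat k 2 E :=
  (vcat_two_iff E).2 ⟨h.xx, h.yy, fun m => by rw [h.xy, h.yx, neg_zero]⟩

lemma stepP [IsAlgClosed k] {E : GSupMod k (Fin 2)} {n : ℕ} {q : Bool}
    (h : Knd (E.θ 0) (E.θ 1) (n + 1)) (hp : TypP (E.θ 0) (E.θ 1))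
    (hq : HasPar E.sigma (E.θ 1) q) :
    ∃ L : GSupMod k (Fin 2), Knd (L.θ 0) (L.θ 1) n ∧ TypP (L.θ 0) (L.θ 1) ∧
      HasPar L.sigma (L.θ 1) (!q) ∧ IsSyzygy (VCat k 2) L E := by
  let V := LinearMap.range (E.θ 0)
  have hV : ∀ w ∈ V, E.sigma w ∈ V := by
    rintro _ ⟨u, rfl⟩
    exact ⟨- E.sigma u, by rw [sigma_theta, map_neg]⟩
  let s := E.sigma.restrict hV
  have hs : ∀ v, s (s v) = v := fun u => Subtype.ext (by simp [s, sigma_sigma])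
  obtain ⟨t, ht, ht'⟩ := avg_retraction s E.sigma hs (sigma_sigma E) V.subtype V.injective_subtype
    (fun a => rfl)
  obtain ⟨F, ε, hF⟩ := fr_exists hs
  obtain ⟨j, hj, hj'⟩ := fr_colift hF h.vcat t ht'
  have tx : ∀ u, t (E.θ 0 u) = ⟨E.θ 0 u, ⟨u, rfl⟩⟩ := fun u => ht ⟨E.θ 0 u, ⟨u, rfl⟩⟩
  have ty : ∀ u, ((t (E.θ 1 u) : V) : E.carrier) = E.θ 1 u := fun u => by
    obtain ⟨w, hw⟩ := hp u
    rw [← hw, tx]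
  simp only [h.xy, map_zero] at hj'
  have hji : Function.Injective j := by
    rw [← LinearMap.ker_eq_bot, eq_bot_iff]
    intro e he
    have he : j e = 0 := he
    rw [hj', LinearEquiv.map_eq_zero_iff] at he
    simp only [Prod.mk_eq_zero, neg_eq_zero] at he
    obtain ⟨-, h1, h2, h3⟩ := he
    have h1' : E.θ 1 e = 0 := by rw [← ty, h1]; rfl
    have h2' : E.θ 0 e = 0 := by
      have := congrArg Subtype.val (tx e)
      rw [h2] at this
      exact this.symm
    obtain ⟨w, rfl⟩ := h.typP_soc (by omega) hp e h2' h1'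
    rw [tx] at h3
    exact congrArg Subtype.val h3
  obtain ⟨j1, j2, j3⟩ := (isHom_two_iff _ _ _).1 hj
  have hFv := fr_vcat hF
  obtain ⟨L, p, hL, hpL, hps, hpk⟩ := exists_quot hFv (LinearMap.range j)
    (by rintro _ ⟨u, rfl⟩; exact ⟨_, j3 u⟩) (by rintro _ ⟨u, rfl⟩; exact ⟨_, j1 u⟩)
    (by rintro _ ⟨u, rfl⟩; exact ⟨_, j2 u⟩)
  obtain ⟨p1, p2, p3⟩ := (isHom_two_iff _ _ _).1 hpL
  obtain ⟨m1, m2, m3⟩ := (vcat_two_iff F).1 hFv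
  obtain ⟨l1, l2, l3⟩ := (vcat_two_iff L).1 hL
  have hpj : ∀ e, p (j e) = 0 := fun e => by
    have : j e ∈ LinearMap.ker p := hpk ▸ LinearMap.mem_range_self j e
    exact this
  obtain ⟨-, hF0, hF1⟩ := id hF
  have lxy : ∀ u, L.θ 0 (L.θ 1 u) = 0 := by
    intro u
    obtain ⟨u, rfl⟩ := hps u
    obtain ⟨⟨a, b, c, d⟩, rfl⟩ := ε.surjective u
    rw [← p2, ← p1, hF1, hF0]
    obtain ⟨w, hw⟩ := a.2
    have : ε (0, 0, 0, a) = j (a : E.carrier) := by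
      rw [hj', ← hw, h.yx, h.xx, tx]
      simp only [map_zero, neg_zero]
      congr 4
      exact Subtype.ext hw.symm
    rw [this, hpj]
  refine ⟨L, ⟨l1, l2, lxy, fun u => ?_, ?_, ?_⟩, ?_, ?_, ?_⟩
  · have := l3 u
    rw [lxy] at this
    exact (neg_eq_zero.1 this.symm)
  · refine (ch_exact j p hji hps hpk.symm _ _ _ _ _ _ j1 j2 p1 p2 m1 m2 m3 ?_).1 h.ch
    exact fun α β hab u hu => fr_exact hF hs α β hab u hu
  · have d1 := LinearMap.finrank_range_add_finrank_ker p
    rw [hpk, LinearMap.range_eq_top.2 hps, finrank_top, LinearMap.finrank_range_of_inj hji,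
      fr_finrank ε, h.dim, h.rkX] at d1
    omega
  · intro u
    obtain ⟨u, rfl⟩ := hps u
    obtain ⟨⟨a, b, c, d⟩, rfl⟩ := ε.surjective u
    obtain ⟨e, he⟩ := a.2
    refine ⟨p (ε (t (E.θ 1 e), 0, -b - t e, 0)), ?_⟩
    rw [← p1, ← p2, hF0, hF1, ← sub_eq_zero, ← map_sub, ← map_sub]
    have : ε ((0, t (E.θ 1 e), 0, -b - t e) - (0, 0, a, -b)) = - j e := by
      rw [hj', ← map_neg, tx]
      congr 1
      have ha : a = ⟨E.θ 0 e, ⟨e, rfl⟩⟩ := Subtype.ext he.symm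
      rw [ha]
      simp
      abel
    rw [this, map_neg, hpj, neg_zero]
  · exact par_exact_right j p hji hps hpk.symm _ _ _ _ _ _ j2 j3 p2 p3 (sigma_sigma F)
      (sigma_theta F 1) m2 (fun u hu => by
        obtain ⟨v, hv⟩ := fr_exact hF hs 0 1 (Or.inr one_ne_zero) u (by simpa using hu)
        exact ⟨v, by simpa using hv⟩) q hq
  · refine ⟨h.vcat, F, p, j, projCover_of (fr_proj hF hs) hpL hps ?_, hj, hji, hpk.symm⟩
    intro u hu
    have hu : u ∈ LinearMap.range j := hpk ▸ hu
    obtain ⟨e, rfl⟩ := hu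
    refine ⟨ε (- t (E.θ 1 e), 0, t e, 0), ε (t (E.θ 0 e), 0, 0, 0), ?_⟩
    rw [hF0, hF1, hj', ← map_add]
    simp

lemma stepM [IsAlgClosed k] {E : GSupMod k (Fin 2)} {n : ℕ} {q : Bool}
    (h : Knd (E.θ 0) (E.θ 1) (n + 1)) (hm : TypM (E.θ 0) (E.θ 1))
    (hq : HasPar E.sigma (E.θ 1) q) :
    ∃ L : GSupMod k (Fin 2), Knd (L.θ 0) (L.θ 1) n ∧ TypM (L.θ 0) (L.θ 1) ∧
      HasPar L.sigma (L.θ 1) (!q) ∧ IsCosyzygy (VCat k 2) L E := by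
  let B := LinearMap.ker (E.θ 0)
  have hB : B ≤ B.comap E.sigma := by
    intro w hw
    have hw : E.θ 0 w = 0 := hw
    show E.θ 0 (E.sigma w) = 0
    rw [← neg_eq_zero, ← sigma_theta, hw, map_zero]
  let s := B.mapQ B E.sigma hB
  have hs : ∀ v, s (s v) = v := by
    intro u; obtain ⟨u, rfl⟩ := B.mkQ_surjective u; simp [s, sigma_sigma]
  obtain ⟨g, hg, hg'⟩ := avg_section E.sigma s (sigma_sigma E) hs B.mkQ B.mkQ_surjective
    (fun a => rfl)
  have hmk : ∀ u, B.mkQ u = 0 ↔ E.θ 0 u = 0 := fun u => by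
    rw [Submodule.mkQ_apply, Submodule.Quotient.mk_eq_zero]; rfl
  obtain ⟨F, ε, hF⟩ := fr_exists hs
  obtain ⟨p, hpE, hp'⟩ := fr_lift hF h.vcat g hg'
  simp only [h.xy, add_zero] at hp'
  have xg : ∀ e, E.θ 0 (g (B.mkQ e)) = E.θ 0 e := fun e => by
    rw [← sub_eq_zero, ← map_sub, ← hmk, map_sub, hg, sub_self]
  have yg : ∀ e, E.θ 1 (g (B.mkQ e)) = E.θ 1 e := fun e => by
    rw [← sub_eq_zero, ← map_sub]
    exact hm _ (by rw [map_sub, xg, sub_self])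
  have hps : Function.Surjective p := by
    intro e
    have h1 := h.typM_rad (by omega) hm (e - g (B.mkQ e)) (by rw [map_sub, xg, sub_self])
    obtain ⟨_, ⟨u, rfl⟩, _, ⟨w, rfl⟩, huw⟩ := Submodule.mem_sup.1 h1
    refine ⟨ε (B.mkQ e, B.mkQ u, B.mkQ w, 0), ?_⟩
    rw [hp', xg, yg, add_assoc, huw]
    abel
  have hpa : ∀ a b c d, p (ε (a, b, c, d)) = 0 → a = 0 := by
    intro a b c d h0
    rw [hp'] at h0
    have h1 := congrArg B.mkQ h0
    rw [map_add, map_add, hg, (hmk _).2 (h.xx _), (hmk _).2 (h.xy _), map_zero] at h1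
    simpa using h1
  obtain ⟨p1, p2, p3⟩ := (isHom_two_iff _ _ _).1 hpE
  have hFv := fr_vcat hF
  obtain ⟨L, j, hL, hjL, hji, hjk⟩ := exists_sub hFv (LinearMap.ker p)
    (fun w hw => by have hw' : p w = 0 := hw
                    simp [p3, hw'])
    (fun w hw => by have hw' : p w = 0 := hw
                    simp [p1, hw'])
    (fun w hw => by have hw' : p w = 0 := hw
                    simp [p2, hw'])
  obtain ⟨j1, j2, j3⟩ := (isHom_two_iff _ _ _).1 hjL
  obtain ⟨m1, m2, m3⟩ := (vcat_two_iff F).1 hFv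
  obtain ⟨l1, l2, l3⟩ := (vcat_two_iff L).1 hL
  have hpj : ∀ e, p (j e) = 0 := fun e => by
    have : j e ∈ LinearMap.ker p := hjk ▸ LinearMap.mem_range_self j e
    exact this
  obtain ⟨-, hF0, hF1⟩ := id hF
  have hjf : ∀ l, ∃ b c d, j l = ε (0, b, c, d) := by
    intro l
    obtain ⟨⟨a, b, c, d⟩, hl⟩ := ε.surjective (j l)
    have h0 := hpj l
    rw [← hl] at h0
    have := hpa _ _ _ _ h0
    subst this
    exact ⟨b, c, d, hl.symm⟩
  have lxy : ∀ u, L.θ 0 (L.θ 1 u) = 0 := by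
    intro u
    obtain ⟨b, c, d, hu⟩ := hjf u
    apply hji
    rw [j1, j2, hu, hF1, hF0, map_zero]
    exact map_zero ε
  refine ⟨L, ⟨l1, l2, lxy, fun u => ?_, ?_, ?_⟩, ?_, ?_, ?_⟩
  · have := l3 u
    rw [lxy] at this
    exact (neg_eq_zero.1 this.symm)
  · refine (ch_exact j p hji hps hjk _ _ _ _ _ _ j1 j2 p1 p2 m1 m2 m3 ?_).2 h.ch
    exact fun α β hab u hu => fr_exact hF hs α β hab u hu
  · have d1 := LinearMap.finrank_range_add_finrank_ker p
    have d2 := Submodule.finrank_quotient_add_finrank B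
    have d3 : Module.finrank k B = n + 1 + 1 := h.kerX
    rw [← hjk, LinearMap.range_eq_top.2 hps, finrank_top, LinearMap.finrank_range_of_inj hji,
      fr_finrank ε] at d1
    have := h.dim
    omega
  · intro u hu
    obtain ⟨b, c, d, hl⟩ := hjf u
    have h1 : j (L.θ 0 u) = 0 := by rw [hu, map_zero]
    rw [j1, hl, hF0, LinearEquiv.map_eq_zero_iff] at h1
    simp only [Prod.mk_eq_zero, true_and] at h1
    subst h1
    have h2 := hpj u
    rw [hl, hp'] at h2
    simp only [map_zero, zero_add, add_zero] at h2
    rw [← hmk, hg] at h2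
    subst h2
    apply hji
    rw [j2, hl, hF1, map_zero, neg_zero]
    exact map_zero ε
  · exact par_exact_left j p hji hps hjk _ _ _ _ _ _ j2 j3 p2 p3 (sigma_sigma F)
      (sigma_theta F 1) m2 (fun u hu => by
        obtain ⟨v, hv⟩ := fr_exact hF hs 0 1 (Or.inr one_ne_zero) u (by simpa using hu)
        exact ⟨v, by simpa using hv⟩) q hq
  · refine ⟨h.vcat, F, j, p, injHull_of (fr_inj hF hs) hjL hji ?_, hpE, hps, hjk.symm⟩
    intro u hu0 hu1
    obtain ⟨⟨a, b, c, d⟩, rfl⟩ := ε.surjective u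
    rw [hF0, LinearEquiv.map_eq_zero_iff] at hu0
    rw [hF1, LinearEquiv.map_eq_zero_iff] at hu1
    simp only [Prod.mk_eq_zero, true_and, neg_eq_zero] at hu0 hu1
    obtain ⟨rfl, rfl⟩ := hu0
    obtain ⟨-, rfl⟩ := hu1
    have : ε (0, 0, 0, d) ∈ LinearMap.range j := by
      rw [hjk, LinearMap.mem_ker, hp']
      simp
    exact this

end steps
end SupAux

set_option linter.unusedSectionVars false
namespace SupAux
open SupCat SupCat.GSupMod

section omega
variable {k : Type} [Field k] [CharZero k]

lemma omega_zero {E : GSupMod k (Fin 2)} {q : Bool}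
    (h : Knd (E.θ 0) (E.θ 1) 0) (hq : HasPar E.sigma (E.θ 1) q) :
    IsTrivial q E ∧ IsOmegaZero (VCat k 2) E E := by
  have hdim : Module.finrank k E.carrier = 1 := h.dim
  have h0 : E.θ 0 = 0 := by
    have := h.rkX
    rw [Submodule.finrank_eq_zero, LinearMap.range_eq_bot] at this
    exact this
  have h1 : E.θ 1 = 0 := by
    have := h.rkY
    rw [Submodule.finrank_eq_zero, LinearMap.range_eq_bot] at this
    exact this
  have hθ : ∀ i, E.θ i = 0 := by
    intro i; fin_cases i
    · exact h0
    · exact h1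
  refine ⟨⟨hdim, hθ, ?_⟩, ?_⟩
  · obtain ⟨z, hz1, hz2, hz3⟩ := hq
    have hz : z ≠ 0 := fun hz => hz3 0 (by rw [map_zero, hz])
    have hspan : ∀ u, ∃ c : k, c • z = u := (finrank_eq_one_iff_of_nonzero' z hz).1 hdim
    have hσ : ∀ u, E.sigma u = sg k q • u := by
      intro u
      obtain ⟨c, rfl⟩ := hspan u
      rw [map_smul, hz1, smul_comm]
    cases q
    · simp only [Bool.false_eq_true, if_false]
      rw [eq_top_iff]
      intro u _
      rw [mem_ev_iff, hσ]
      simp [sg]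
    · simp only [if_true]
      rw [eq_top_iff]
      intro u _
      rw [mem_od_iff, hσ]
      simp [sg]
  · obtain ⟨Q, ε, hQ⟩ := fr_exists (k := k) (V := PUnit) (s := LinearMap.id) (fun v => rfl)
    have hQ0 : ∀ q : Q.carrier, q = 0 := fun q => by
      obtain ⟨v, rfl⟩ := ε.surjective q
      rw [Subsingleton.elim v 0, map_zero]
    have : Subsingleton Q.carrier := ⟨fun a b => by rw [hQ0 a, hQ0 b]⟩
    refine ⟨Q, fr_proj hQ (fun v => rfl), ?_, ?_⟩
    · rintro A B hA ⟨φ, -, -, hφ⟩ a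
      have hA0 : ∀ i a, A.θ i a = 0 := by
        intro i a
        have := hφ i (φ.symm (a, 0))
        rw [hθ] at this
        simp at this
        exact congrArg Prod.fst this.symm
      obtain ⟨b, hb⟩ := proj_exact hA ![1, 0] (fun h => by
        have := congrFun h 0
        simp at this) a (by simp [actOf, hA0])
      rw [← hb]
      simp [actOf, hA0]
    · let φ : E.carrier ≃ₗ[k] E.carrier × Q.carrier :=
        { toFun := fun e => (e, 0)
          invFun := fun e => e.1
          map_add' := fun _ _ => by simp
          map_smul' := fun _ _ => by simp
          left_inv := fun _ => rfl
          right_inv := fun _ => Prod.ext rfl (Subsingleton.elim _ _) }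
      exact isDsum_of _ _ _ φ (fun s => Prod.ext rfl (Subsingleton.elim _ _))
        (fun i s => Prod.ext rfl (Subsingleton.elim _ _))

lemma omega_pow [IsAlgClosed k] (n : ℕ) : ∀ (E : GSupMod k (Fin 2)) (q : Bool),
    Knd (E.θ 0) (E.θ 1) n → TypP (E.θ 0) (E.θ 1) → HasPar E.sigma (E.θ 1) q →
    ∃ K, IsTrivial (not^[n] q) K ∧ IsOmegaPow (VCat k 2) n K E := by
  induction n with
  | zero =>
    intro E q h _ hq
    exact ⟨E, (omega_zero h hq).1, (omega_zero h hq).2⟩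
  | succ n ih =>
    intro E q h hp hq
    obtain ⟨L, hL1, hL2, hL3, hL4⟩ := stepP h hp hq
    obtain ⟨K, hK1, hK2⟩ := ih L (!q) hL1 hL2 hL3
    exact ⟨K, hK1, L, hK2, hL4⟩

lemma omega_neg [IsAlgClosed k] (n : ℕ) : ∀ (E : GSupMod k (Fin 2)) (q : Bool),
    Knd (E.θ 0) (E.θ 1) n → TypM (E.θ 0) (E.θ 1) → HasPar E.sigma (E.θ 1) q →
    ∃ K, IsTrivial (not^[n] q) K ∧ IsOmegaNegPow (VCat k 2) n K E := by
  induction n with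
  | zero =>
    intro E q h _ hq
    exact ⟨E, (omega_zero h hq).1, (omega_zero h hq).2⟩
  | succ n ih =>
    intro E q h hp hq
    obtain ⟨L, hL1, hL2, hL3, hL4⟩ := stepM h hp hq
    obtain ⟨K, hK1, hK2⟩ := ih L (!q) hL1 hL2 hL3
    exact ⟨K, hK1, L, hK2, hL4⟩

lemma isOmega_pos {n : ℕ} {K E : GSupMod k (Fin 2)} (h : IsOmegaPow (VCat k 2) n K E) :
    IsOmega (VCat k 2) (n : ℤ) K E := by
  unfold IsOmega
  simpa using h

lemma isOmega_neg {n : ℕ} {K E : GSupMod k (Fin 2)} (h : IsOmegaNegPow (VCat k 2) n K E) :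
    IsOmega (VCat k 2) (-(n : ℤ)) K E := by
  unfold IsOmega
  rcases n with _ | n
  · simp only [Nat.cast_zero, neg_zero, le_refl, if_true]
    exact h
  · rw [if_neg (by omega)]
    simpa using h

end omega
end SupAux

set_option linter.unusedSectionVars false
namespace SupAux
open SupCat SupCat.GSupMod

section pencil
variable {k : Type} [Field k]
variable {U W W' : Type} [AddCommGroup U] [Module k U] [FiniteDimensional k U]
  [AddCommGroup W] [Module k W] [FiniteDimensional k W]
  [AddCommGroup W'] [Module k W'] [FiniteDimensional k W']

def ex {U : Type} [AddCommGroup U] {N : ℕ} (t : Fin N → U) (m : ℕ) : U :=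
  if h : m < N then t ⟨m, h⟩ else 0

/-- shifted extension by zero -/
def sh {U : Type} [AddCommGroup U] {N : ℕ} (t : Fin N → U) : ℕ → U
  | 0 => 0
  | m + 1 => ex t m

lemma ex_fin {N : ℕ} (t : Fin N → U) (i : Fin N) : ex t i = t i := by simp [ex]
lemma ex_lt {N : ℕ} (t : Fin N → U) (i : ℕ) (h : i < N) : ex t i = t ⟨i, h⟩ := by simp [ex, h]
lemma ex_ge {N : ℕ} (t : Fin N → U) (i : ℕ) (h : N ≤ i) : ex t i = 0 := by
  simp [ex, Nat.not_lt.2 h]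
lemma ex_add {N : ℕ} (t t' : Fin N → U) (i : ℕ) : ex (t + t') i = ex t i + ex t' i := by
  unfold ex; split_ifs <;> simp
lemma ex_smul {N : ℕ} (c : k) (t : Fin N → U) (i : ℕ) : ex (c • t) i = c • ex t i := by
  unfold ex; split_ifs <;> simp
lemma sh_add {N : ℕ} (t t' : Fin N → U) (i : ℕ) : sh (t + t') i = sh t i + sh t' i := by
  cases i
  · simp [sh]
  · exact ex_add _ _ _
lemma sh_smul {N : ℕ} (c : k) (t : Fin N → U) (i : ℕ) : sh (c • t) i = c • sh t i := by
  cases i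
  · simp [sh]
  · exact ex_smul _ _ _
lemma ex_map {N : ℕ} (f : U →ₗ[k] W) (t : Fin N → U) (i : ℕ) :
    ex (fun j => f (t j)) i = f (ex t i) := by
  unfold ex; split_ifs <;> simp
lemma sh_map {N : ℕ} (f : U →ₗ[k] W) (t : Fin N → U) (i : ℕ) :
    sh (fun j => f (t j)) i = f (sh t i) := by
  cases i
  · simp [sh]
  · exact ex_map _ _ _

/-- the first pencil map -/
def Psi (N : ℕ) (X Y : U →ₗ[k] W) : (Fin (N + 1) → U) →ₗ[k] (Fin N → W) where
  toFun t := fun i => X (t i.castSucc) + Y (t i.succ)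
  map_add' t t' := by ext i; simp; abel
  map_smul' c t := by ext i; simp

/-- the second pencil map -/
def Phi (N : ℕ) (X Y : U →ₗ[k] W) : (Fin N → U) →ₗ[k] (Fin (N + 1) → W) where
  toFun t := fun i => X (ex t i) + Y (sh t i)
  map_add' t t' := by ext i; simp [ex_add, sh_add]; abel
  map_smul' c t := by ext i; simp [ex_smul, sh_smul]

lemma Psi_apply (N : ℕ) (X Y : U →ₗ[k] W) (t : Fin (N + 1) → U) (i : Fin N) :
    Psi N X Y t i = X (t i.castSucc) + Y (t i.succ) := rfl
lemma Phi_apply (N : ℕ) (X Y : U →ₗ[k] W) (t : Fin N → U) (i : Fin (N + 1)) :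
    Phi N X Y t i = X (ex t i) + Y (sh t i) := rfl

lemma rkk_comp_inj (f : U →ₗ[k] W) (g : W →ₗ[k] W') (hg : Function.Injective g) :
    rkk (g ∘ₗ f) = rkk f := by
  unfold rkk
  rw [LinearMap.range_comp]
  exact (LinearEquiv.finrank_eq (Submodule.equivMapOfInjective _ hg _)).symm

lemma rkk_surj (f : U →ₗ[k] W) (hf : Function.Surjective f) : rkk f = Module.finrank k W := by
  unfold rkk
  rw [LinearMap.range_eq_top.2 hf, finrank_top]

lemma rkk_add_ker (f : U →ₗ[k] W) :
    rkk f + Module.finrank k (LinearMap.ker f) = Module.finrank k U :=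
  LinearMap.finrank_range_add_finrank_ker f

lemma pi_finrank {N : ℕ} (K : Submodule k U) (S : Submodule k (Fin N → U))
    (h : ∀ t, t ∈ S ↔ ∀ i, t i ∈ K) : Module.finrank k S = N * Module.finrank k K := by
  have hi : Function.Injective (K.subtype.compLeft (Fin N)) := by
    intro a b hab
    ext i
    exact congrFun hab i
  have hS : S = LinearMap.range (K.subtype.compLeft (Fin N)) := by
    ext t
    rw [h]
    constructor
    · intro ht
      exact ⟨fun i => ⟨t i, ht i⟩, rfl⟩
    · rintro ⟨s, rfl⟩ i
      exact (s i).2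
  rw [hS, LinearMap.finrank_range_of_inj hi, Module.finrank_pi_fintype]
  simp

variable {X Y : U →ₗ[k] U} {n : ℕ}

lemma Knd.psiM [IsAlgClosed k] (h : Knd X Y n) (hm : TypM X Y) (N : ℕ) (hN : n ≤ N) :
    rkk (Psi N X Y) = n * (N + 1) := by
  have hk : ∀ t, t ∈ LinearMap.ker (Psi N X Y) ↔ ∀ i, t i ∈ LinearMap.ker X := by
    intro t
    constructor
    · intro ht
      have ht : Psi N X Y t = 0 := ht
      let K := LinearMap.ker X
      have hKY : K ≤ LinearMap.ker Y := fun u hu => hm u hu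
      have hdim : Module.finrank k (U ⧸ K) ≤ N := by
        have d2 := Submodule.finrank_quotient_add_finrank K
        have d3 : Module.finrank k K = n + 1 := h.kerX
        have := h.dim
        omega
      have := kron (K.liftQ X le_rfl) (K.liftQ Y hKY) (by
        intro α β hab u hu
        obtain ⟨u, rfl⟩ := K.mkQ_surjective u
        simp only [Submodule.mkQ_apply, Submodule.liftQ_apply] at hu
        exact (Submodule.Quotient.mk_eq_zero K).2 (h.typM_ker hm α β hab u hu)) N hdim
        (fun i => K.mkQ (ex t i)) (by
          intro i hi
          have := congrFun ht ⟨i, hi⟩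
          rw [Psi_apply] at this
          rw [ex_lt t i (by omega), ex_lt t (i + 1) (by omega)]
          exact this)
      intro i
      have h1 := this i (by omega)
      rw [ex_fin] at h1
      exact (Submodule.Quotient.mk_eq_zero K).1 h1
    · intro ht
      have ht : ∀ i, X (t i) = 0 := ht
      show Psi N X Y t = 0
      ext i
      rw [Psi_apply, ht, hm _ (ht _)]
      simp
  have h1 := rkk_add_ker (Psi N X Y)
  rw [pi_finrank _ _ hk, h.kerX, Module.finrank_pi_fintype] at h1
  simp only [h.dim, Finset.sum_const, Finset.card_univ, Fintype.card_fin, smul_eq_mul] at h1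
  nlinarith

lemma Knd.phiM (h : Knd X Y n) (hm : TypM X Y) (N : ℕ) :
    rkk (Phi N X Y) = n * N := by
  have hk : ∀ t, t ∈ LinearMap.ker (Phi N X Y) ↔ ∀ i, t i ∈ LinearMap.ker X := by
    intro t
    constructor
    · intro ht
      have ht : Phi N X Y t = 0 := ht
      have : ∀ i, i < N → X (ex t i) = 0 := by
        intro i
        induction i with
        | zero =>
          intro hi
          have := congrFun ht ⟨0, by omega⟩
          rw [Phi_apply] at this
          simpa [sh] using this
        | succ i ih =>
          intro hi
          have := congrFun ht ⟨i + 1, by omega⟩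
          rw [Phi_apply] at this
          simp only [sh, hm _ (ih (by omega)), add_zero] at this
          exact this
      intro i
      have := this i i.2
      rw [ex_fin] at this
      exact this
    · intro ht
      have ht : ∀ i, X (t i) = 0 := ht
      have hx : ∀ i, X (ex t i) = 0 := fun i => by
        unfold ex; split_ifs
        · exact ht _
        · simp
      have hs : ∀ i, Y (sh t i) = 0 := fun i => by
        cases i
        · simp [sh]
        · exact hm _ (hx _)
      show Phi N X Y t = 0
      ext i
      rw [Phi_apply, hx, hs]
      simp
  have h1 := rkk_add_ker (Phi N X Y)
  rw [pi_finrank _ _ hk, h.kerX, Module.finrank_pi_fintype] at h1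
  simp only [h.dim, Finset.sum_const, Finset.card_univ, Fintype.card_fin, smul_eq_mul] at h1
  nlinarith

lemma Knd.psiP (h : Knd X Y n) (hp : TypP X Y) (N : ℕ) : rkk (Psi N X Y) = n * N := by
  let B := LinearMap.range X
  let X' : U →ₗ[k] B := X.codRestrict B (fun u => ⟨u, rfl⟩)
  let Y' : U →ₗ[k] B := Y.codRestrict B (fun u => hp u)
  have e : Psi N X Y = (B.subtype.compLeft (Fin N)) ∘ₗ Psi N X' Y' := rfl
  have hi : Function.Injective (B.subtype.compLeft (Fin N)) := by
    intro a b hab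
    ext i
    exact congrFun hab i
  have hY : ∀ b : B, ∃ u, Y' u = b := by
    rintro ⟨_, u, rfl⟩
    obtain ⟨w, hw⟩ := h.typP_range hp 0 1 (by simp) u
    have hw2 : Y w = X u := by simpa using hw
    exact ⟨w, Subtype.ext hw2⟩
  rw [e, rkk_comp_inj _ _ hi, rkk_surj, Module.finrank_pi_fintype]
  · have : Module.finrank k B = n := h.rkX
    simp [this, mul_comm]
  · intro b
    choose g hg using hY
    let t : ℕ → U := fun i => Nat.rec 0 (fun i u => g (ex b i - X' u)) i
    refine ⟨fun i => t i, ?_⟩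
    funext i
    rw [Psi_apply]
    show X' (t i) + Y' (t (i + 1)) = b i
    have : t (i + 1) = g (ex b i - X' (t i)) := rfl
    rw [this, hg, ex_fin]
    abel

lemma Knd.phiP [IsAlgClosed k] (h : Knd X Y n) (hp : TypP X Y) (N : ℕ) (hN : n ≤ N) :
    rkk (Phi N X Y) = n * (N + 1) := by
  let B := LinearMap.range X
  let X' : U →ₗ[k] B := X.codRestrict B (fun u => ⟨u, rfl⟩)
  let Y' : U →ₗ[k] B := Y.codRestrict B (fun u => hp u)
  have e : Phi N X Y = (B.subtype.compLeft (Fin (N + 1))) ∘ₗ Phi N X' Y' := rfl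
  have hi : Function.Injective (B.subtype.compLeft (Fin (N + 1))) := by
    intro a b hab
    ext i
    exact congrFun hab i
  have hB : Module.finrank k B = n := h.rkX
  rw [e, rkk_comp_inj _ _ hi, rkk_surj, Module.finrank_pi_fintype]
  · simp [hB, mul_comm]
  · rw [← LinearMap.dualMap_injective_iff, ← LinearMap.ker_eq_bot, eq_bot_iff]
    intro f hf
    have hf : ∀ t, f (Phi N X' Y' t) = 0 := fun t => LinearMap.congr_fun hf t
    let g : ℕ → Module.Dual k B := fun i =>
      if hi : i < N + 1 then f ∘ₗ LinearMap.single k (fun _ => B) ⟨i, hi⟩ else 0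
    have hg := kron X'.dualMap Y'.dualMap (by
      intro α β hab f hf
      ext ⟨_, u, rfl⟩
      obtain ⟨w, hw⟩ := h.typP_range hp α β hab u
      have h1 : α • f (X' w) + β • f (Y' w) = 0 := LinearMap.congr_fun hf w
      have h2 : α • X' w + β • Y' w = ⟨X u, u, rfl⟩ := Subtype.ext hw
      rw [← map_smul f, ← map_smul f, ← map_add, h2] at h1
      simpa using h1) N (by rw [Subspace.dual_finrank_eq, hB]; exact hN) g (by
      intro i hi
      ext u
      have h1 := hf (Pi.single ⟨i, hi⟩ u)
      have h2 : Phi N X' Y' (Pi.single ⟨i, hi⟩ u) =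
          Pi.single ⟨i, by omega⟩ (X' u) + Pi.single ⟨i + 1, by omega⟩ (Y' u) := by
        have hex : ∀ l : ℕ, ex (Pi.single (⟨i, hi⟩ : Fin N) u) l = if l = i then u else 0 := by
          intro l
          unfold ex
          by_cases hl : l = i
          · subst hl; simp [hi]
          · simp [hl, Pi.single_apply]
        funext ⟨l, hl⟩
        rw [Phi_apply, Pi.add_apply]
        congr 1
        · simp only [hex, Pi.single_apply, Fin.mk.injEq]
          split_ifs <;> simp
        · cases l with
          | zero => simp [sh, Pi.single_apply]
          | succ l =>
            simp only [sh, hex, Pi.single_apply, Fin.mk.injEq, Nat.add_right_cancel_iff]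
            split_ifs <;> simp
      rw [h2, map_add] at h1
      simp only [g, dif_pos (show i < N + 1 by omega), dif_pos (show i + 1 < N + 1 by omega)]
      exact h1)
    show f = 0
    apply LinearMap.pi_ext'
    intro i
    have := hg i (by omega)
    simp only [g, i.2, dif_pos] at this
    exact this

end pencil
end SupAux

set_option linter.unusedSectionVars false
namespace SupAux
open SupCat SupCat.GSupMod

section freeranks
variable {k : Type} [Field k] [CharZero k]

lemma rkk_factor {U W T : Type} [AddCommGroup U] [Module k U] [FiniteDimensional k U]
    [AddCommGroup W] [Module k W] [FiniteDimensional k W]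
    [AddCommGroup T] [Module k T] [FiniteDimensional k T]
    (f : U →ₗ[k] W) (S : U →ₗ[k] T) (G : T →ₗ[k] W) (h : ∀ u, f u = G (S u))
    (hS : Function.Surjective S) (hG : Function.Injective G) : rkk f = Module.finrank k T := by
  have : f = G ∘ₗ S := LinearMap.ext h
  rw [this, rkk_comp_inj _ _ hG, rkk_surj _ hS]

variable {V : Type} [AddCommGroup V] [Module k V] [FiniteDimensional k V] {s : V →ₗ[k] V}
variable {Q : GSupMod k (Fin 2)} {ε : (V × V × V × V) ≃ₗ[k] Q.carrier}

lemma fr_th0 (h : IsFr V s Q ε) (q : Q.carrier) :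
    Q.θ 0 q = ε (0, (ε.symm q).1, 0, (ε.symm q).2.2.1) := by
  obtain ⟨⟨a, b, c, d⟩, rfl⟩ := ε.surjective q
  rw [h.2.1]; simp

lemma fr_th1 (h : IsFr V s Q ε) (q : Q.carrier) :
    Q.θ 1 q = ε (0, 0, (ε.symm q).1, - (ε.symm q).2.1) := by
  obtain ⟨⟨a, b, c, d⟩, rfl⟩ := ε.surjective q
  rw [h.2.2]; simp

lemma fr_psi (h : IsFr V s Q ε) (N : ℕ) (hN : 1 ≤ N) :
    rkk (Psi N (Q.θ 0) (Q.θ 1)) = (2 * N + 1) * Module.finrank k V := by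
  let S : (Fin (N + 1) → Q.carrier) →ₗ[k] (Fin (N + 1) → V) × (Fin N → V) :=
    { toFun := fun t => (fun i => (ε.symm (t i)).1,
        fun j => (ε.symm (t j.castSucc)).2.2.1 - (ε.symm (t j.succ)).2.1)
      map_add' := by
        intro t t'
        refine Prod.ext ?_ ?_ <;> funext i <;> simp
        abel
      map_smul' := by
        intro c t
        refine Prod.ext ?_ ?_ <;> funext i <;> simp [smul_sub] }
  let G : (Fin (N + 1) → V) × (Fin N → V) →ₗ[k] (Fin N → Q.carrier) :=
    { toFun := fun p j => ε (0, p.1 j.castSucc, p.1 j.succ, p.2 j)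
      map_add' := by
        intro t t'
        funext i
        simp [← map_add]
      map_smul' := by
        intro c t
        funext i
        simp [← map_smul] }
  rw [rkk_factor _ S G]
  · rw [Module.finrank_prod, Module.finrank_pi_fintype, Module.finrank_pi_fintype]; simp; ring
  · intro t
    funext j
    show Q.θ 0 (t j.castSucc) + Q.θ 1 (t j.succ) = ε (0, (ε.symm (t j.castSucc)).1,
      (ε.symm (t j.succ)).1, (ε.symm (t j.castSucc)).2.2.1 - (ε.symm (t j.succ)).2.1)
    rw [fr_th0 h, fr_th1 h, ← map_add]
    simp [sub_eq_add_neg]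
  · rintro ⟨a, e⟩
    refine ⟨fun i => ε (a i, 0, ex e i, 0), ?_⟩
    refine Prod.ext ?_ ?_
    · funext i; simp [S]
    · funext i; simp [S, ex]
  · rintro ⟨a, e⟩ ⟨a', e'⟩ hG
    have h1 : ∀ j : Fin N, a j.castSucc = a' j.castSucc ∧ a j.succ = a' j.succ ∧ e j = e' j := by
      intro j
      have := congrFun hG j
      simpa [G] using this
    refine Prod.ext ?_ ?_
    · funext i
      refine Fin.cases ?_ (fun j => (h1 j).2.1) i
      exact (h1 ⟨0, hN⟩).1
    · funext j; exact (h1 j).2.2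

lemma fr_phi (h : IsFr V s Q ε) (N : ℕ) (hN : 1 ≤ N) :
    rkk (Phi N (Q.θ 0) (Q.θ 1)) = (2 * N + 1) * Module.finrank k V := by
  let pa : Q.carrier →ₗ[k] V := LinearMap.fst k V _ ∘ₗ ε.symm.toLinearMap
  let pb : Q.carrier →ₗ[k] V := LinearMap.fst k V _ ∘ₗ LinearMap.snd k V _ ∘ₗ ε.symm.toLinearMap
  let pc : Q.carrier →ₗ[k] V := LinearMap.fst k V V ∘ₗ LinearMap.snd k V _ ∘ₗ
    LinearMap.snd k V _ ∘ₗ ε.symm.toLinearMap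
  let S : (Fin N → Q.carrier) →ₗ[k] (Fin N → V) × (Fin (N + 1) → V) :=
    { toFun := fun t => (fun i => pa (t i), fun j => pc (ex t j) - pb (sh t j))
      map_add' := by
        intro t t'
        refine Prod.ext ?_ ?_ <;> funext i <;> simp [ex_add, sh_add]
        abel
      map_smul' := by
        intro c t
        refine Prod.ext ?_ ?_ <;> funext i <;> simp [smul_sub, ex_smul, sh_smul] }
  let G : (Fin N → V) × (Fin (N + 1) → V) →ₗ[k] (Fin (N + 1) → Q.carrier) :=
    { toFun := fun p j => ε (0, ex p.1 j, sh p.1 j, p.2 j)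
      map_add' := by
        intro t t'
        funext i
        simp [← map_add, ex_add, sh_add]
      map_smul' := by
        intro c t
        funext i
        simp [← map_smul, ex_smul, sh_smul] }
  rw [rkk_factor _ S G]
  · rw [Module.finrank_prod, Module.finrank_pi_fintype, Module.finrank_pi_fintype]; simp; ring
  · intro t
    funext j
    show Q.θ 0 (ex t j) + Q.θ 1 (sh t j) = ε (0, ex (fun i => pa (t i)) j,
      sh (fun i => pa (t i)) j, pc (ex t j) - pb (sh t j))
    rw [fr_th0 h, fr_th1 h, ← map_add, ex_map, sh_map]
    simp [sub_eq_add_neg, pa, pb, pc]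
  · rintro ⟨a, e⟩
    refine ⟨fun i => ε (a i, - e i.succ, if (i : ℕ) = 0 then e 0 else 0, 0), ?_⟩
    refine Prod.ext ?_ ?_
    · funext i; simp [S, pa]
    · funext i
      show pc (ex _ i) - pb (sh _ i) = e i
      rw [← ex_map, ← sh_map]
      refine Fin.cases ?_ (fun j => ?_) i
      · simp [ex, sh, pc, pb, show 0 < N from hN]
      · have : (Fin.succ j : ℕ) = (j : ℕ) + 1 := rfl
        rw [this]
        simp [sh, ex, pc, pb]
  · rintro ⟨a, e⟩ ⟨a', e'⟩ hG
    have h1 : ∀ j : Fin (N + 1), ex a j = ex a' j ∧ e j = e' j := by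
      intro j
      have h0 := congrFun hG j
      have h2 : ex a j = ex a' j ∧ sh a j = sh a' j ∧ e j = e' j := by simpa [G] using h0
      exact ⟨h2.1, h2.2.2⟩
    refine Prod.ext ?_ ?_
    · funext i
      have h2 := (h1 i.castSucc).1
      rwa [Fin.val_castSucc, ex_fin, ex_fin] at h2
    · funext j; exact (h1 j).2
end freeranks

section additivity
variable {k : Type} [Field k]
variable {U W W' : Type} [AddCommGroup U] [Module k U] [FiniteDimensional k U]
  [AddCommGroup W] [Module k W] [FiniteDimensional k W]
  [AddCommGroup W'] [Module k W'] [FiniteDimensional k W']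

def piDec (N : ℕ) (φ : U ≃ₗ[k] W × W') : (Fin N → U) ≃ₗ[k] (Fin N → W) × (Fin N → W') where
  toFun t := (fun i => (φ (t i)).1, fun i => (φ (t i)).2)
  map_add' t t' := by refine Prod.ext ?_ ?_ <;> funext i <;> simp
  map_smul' c t := by refine Prod.ext ?_ ?_ <;> funext i <;> simp
  invFun p := fun i => φ.symm (p.1 i, p.2 i)
  left_inv t := by funext i; simp
  right_inv p := by simp

variable (φ : U ≃ₗ[k] W × W') {X Y : U →ₗ[k] U} {X1 Y1 : W →ₗ[k] W} {X2 Y2 : W' →ₗ[k] W'}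

lemma rkk_add (hX : ∀ u, φ (X u) = (X1 (φ u).1, X2 (φ u).2)) : rkk X = rkk X1 + rkk X2 := by
  rw [← rkk_prod]
  exact rkk_conj φ φ _ _ hX

lemma psi_add (hX : ∀ u, φ (X u) = (X1 (φ u).1, X2 (φ u).2))
    (hY : ∀ u, φ (Y u) = (Y1 (φ u).1, Y2 (φ u).2)) (N : ℕ) :
    rkk (Psi N X Y) = rkk (Psi N X1 Y1) + rkk (Psi N X2 Y2) := by
  rw [← rkk_prod]
  refine rkk_conj (piDec _ φ) (piDec _ φ) _ _ (fun t => ?_)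
  refine Prod.ext ?_ ?_ <;> funext i <;> simp [piDec, Psi_apply, hX, hY]

lemma phi_add (hX : ∀ u, φ (X u) = (X1 (φ u).1, X2 (φ u).2))
    (hY : ∀ u, φ (Y u) = (Y1 (φ u).1, Y2 (φ u).2)) (N : ℕ) :
    rkk (Phi N X Y) = rkk (Phi N X1 Y1) + rkk (Phi N X2 Y2) := by
  rw [← rkk_prod]
  refine rkk_conj (piDec _ φ) (piDec _ φ) _ _ (fun t => ?_)
  have e1 : ∀ j : ℕ, ex (fun i => (φ (t i)).1) j = (φ (ex t j)).1 :=
    fun j => ex_map (LinearMap.fst k W W' ∘ₗ φ.toLinearMap) t j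
  have e2 : ∀ j : ℕ, ex (fun i => (φ (t i)).2) j = (φ (ex t j)).2 :=
    fun j => ex_map (LinearMap.snd k W W' ∘ₗ φ.toLinearMap) t j
  have e3 : ∀ j : ℕ, sh (fun i => (φ (t i)).1) j = (φ (sh t j)).1 :=
    fun j => sh_map (LinearMap.fst k W W' ∘ₗ φ.toLinearMap) t j
  have e4 : ∀ j : ℕ, sh (fun i => (φ (t i)).2) j = (φ (sh t j)).2 :=
    fun j => sh_map (LinearMap.snd k W W' ∘ₗ φ.toLinearMap) t j
  refine Prod.ext ?_ ?_ <;> funext i <;> simp [piDec, Phi_apply, hX, hY, e1, e2, e3, e4]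

variable (e : U ≃ₗ[k] W)
lemma psi_conj (hX : ∀ u, e (X u) = X1 (e u)) (hY : ∀ u, e (Y u) = Y1 (e u)) (N : ℕ) :
    rkk (Psi N X Y) = rkk (Psi N X1 Y1) := by
  refine rkk_conj (LinearEquiv.piCongrRight fun _ => e) (LinearEquiv.piCongrRight fun _ => e)
    _ _ (fun t => ?_)
  funext i
  simp [Psi_apply, hX, hY]

lemma phi_conj (hX : ∀ u, e (X u) = X1 (e u)) (hY : ∀ u, e (Y u) = Y1 (e u)) (N : ℕ) :
    rkk (Phi N X Y) = rkk (Phi N X1 Y1) := by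
  refine rkk_conj (LinearEquiv.piCongrRight fun _ => e) (LinearEquiv.piCongrRight fun _ => e)
    _ _ (fun t => ?_)
  have e1 : ∀ j : ℕ, ex (fun i => e (t i)) j = e (ex t j) :=
    fun j => ex_map e.toLinearMap t j
  have e3 : ∀ j : ℕ, sh (fun i => e (t i)) j = e (sh t j) :=
    fun j => sh_map e.toLinearMap t j
  funext i
  have : (LinearEquiv.piCongrRight fun _ => e) t = fun i => e (t i) := rfl
  rw [this, Phi_apply, e1, e3, ← hX, ← hY, ← map_add]
  rfl
end additivity
end SupAux

set_option linter.unusedSectionVars false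
namespace SupAux
open SupCat SupCat.GSupMod

section mainR
variable {k : Type} [Field k] [CharZero k]

lemma fr_half {V : Type} [AddCommGroup V] [Module k V] [FiniteDimensional k V] {s : V →ₗ[k] V}
    {Q : GSupMod k (Fin 2)} {ε : (V × V × V × V) ≃ₗ[k] Q.carrier}
    (h : IsFr V s Q ε) (hs : ∀ v, s (s v) = v) (α β : k) (hab : α ≠ 0 ∨ β ≠ 0) :
    rkk (α • Q.θ 0 + β • Q.θ 1) = 2 * Module.finrank k V := by
  obtain ⟨m1, m2, m3⟩ := (vcat_two_iff Q).1 (fr_vcat h)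
  have h1 : LinearMap.range (α • Q.θ 0 + β • Q.θ 1) = LinearMap.ker (α • Q.θ 0 + β • Q.θ 1) := by
    ext m
    constructor
    · rintro ⟨u, rfl⟩
      simp [m1, m2, m3, smul_smul, mul_comm]
    · intro hm
      exact fr_exact h hs α β hab m hm
  have h2 := rkk_add_ker (α • Q.θ 0 + β • Q.θ 1)
  rw [← h1] at h2
  have h3 := fr_finrank (k := k) ε
  unfold rkk at h2 ⊢
  omega

lemma main_R [IsAlgClosed k] (R : GSupMod k (Fin 2)) (hR : VCat k 2 R)
    (hc : CH (R.θ 0) (R.θ 1)) (q : Bool) (hq : HasPar R.sigma (R.θ 1) q) :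
    ∃ s : ℤ, (∀ N : ℕ, Module.finrank k R.carrier ≤ N → 1 ≤ N →
        4 * (rkk (Psi N (R.θ 0) (R.θ 1)) : ℤ) =
          (2 * N + 1) * (Module.finrank k R.carrier - 1) - 2 * s ∧
        4 * (rkk (Phi N (R.θ 0) (R.θ 1)) : ℤ) =
          (2 * N + 1) * (Module.finrank k R.carrier - 1) + 2 * s) ∧
      ∃ K E P : GSupMod k (Fin 2), IsTrivial (not^[s.natAbs] q) K ∧ IsOmega (VCat k 2) s K E ∧
        IsProjective (VCat k 2) P ∧ IsDsum E P R := by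
  obtain ⟨E, Q, V, t, ε, φ, hE, hxy, ht, hfr, hφσ, hφ⟩ := decomp hR
  obtain ⟨m1, m2, m3⟩ := (vcat_two_iff E).1 hE
  have hdim : Module.finrank k R.carrier =
      Module.finrank k E.carrier + 4 * Module.finrank k V := by
    rw [φ.finrank_eq, Module.finrank_prod, fr_finrank ε]
  have hcE : CH (E.θ 0) (E.θ 1) := by
    rw [ch_iff] at hc ⊢
    intro α β hab
    have h1 := hc α β hab
    have h2 := rkk_add φ (X := α • R.θ 0 + β • R.θ 1) (X1 := α • E.θ 0 + β • E.θ 1)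
      (X2 := α • Q.θ 0 + β • Q.θ 1) (by intro u; simp [hφ])
    rw [fr_half hfr ht α β hab] at h2
    omega
  obtain ⟨n, hn⟩ : ∃ n, Module.finrank k E.carrier = 2 * n + 1 := by
    have h1 := (ch_iff _ _).1 hcE 1 0 (by simp)
    exact ⟨_, h1.symm⟩
  have hK : Knd (E.θ 0) (E.θ 1) n := ⟨m1, m2, hxy, fun u => by
    have h1 := m3 u
    have h2 := hxy u
    simp_all, hcE, hn⟩
  have hqE : HasPar E.sigma (E.θ 1) q := by
    obtain ⟨z, z1, z2, z3⟩ := hq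
    have e1 := hφσ z
    rw [z1, map_smul] at e1
    have e2 := hφ 1 z
    rw [z2, map_zero] at e2
    have e2a : E.θ 1 (φ z).1 = 0 := (congrArg Prod.fst e2).symm
    have e2b : Q.θ 1 (φ z).2 = 0 := (congrArg Prod.snd e2).symm
    refine ⟨(φ z).1, (congrArg Prod.fst e1).symm, e2a, fun u hu => ?_⟩
    obtain ⟨w, hw⟩ := fr_exact hfr ht 0 1 (by simp) (φ z).2 (by simpa using e2b)
    have hw : Q.θ 1 w = (φ z).2 := by simpa using hw
    apply z3 (φ.symm (u, w))
    apply φ.injective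
    rw [hφ]
    simp [hu, hw]
  have hD : IsDsum E Q R := by
    refine isDsum_of E Q R φ ?_ ?_
    all_goals first | exact hφσ | exact hφ
  have hpsi : ∀ N, 1 ≤ N → rkk (Psi N (R.θ 0) (R.θ 1)) = rkk (Psi N (E.θ 0) (E.θ 1)) +
      (2 * N + 1) * Module.finrank k V := by
    intro N hN
    rw [psi_add φ (hφ 0) (hφ 1), fr_psi hfr N hN]
  have hphi : ∀ N, 1 ≤ N → rkk (Phi N (R.θ 0) (R.θ 1)) = rkk (Phi N (E.θ 0) (E.θ 1)) +
      (2 * N + 1) * Module.finrank k V := by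
    intro N hN
    rw [phi_add φ (hφ 0) (hφ 1), fr_phi hfr N hN]
  rcases hK.dich with hp | hm
  · obtain ⟨K, k1, k2⟩ := omega_pow n E q hK hp hqE
    refine ⟨n, fun N hN hN1 => ?_, K, E, Q, by simpa using k1, isOmega_pos k2, fr_proj hfr ht, hD⟩
    rw [hpsi N hN1, hphi N hN1, hK.psiP hp, hK.phiP hp N (by omega), hdim, hn]
    push_cast
    constructor <;> ring
  · obtain ⟨K, k1, k2⟩ := omega_neg n E q hK hm hqE
    refine ⟨-n, fun N hN hN1 => ?_, K, E, Q, by simpa using k1, isOmega_neg k2, fr_proj hfr ht, hD⟩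
    rw [hpsi N hN1, hphi N hN1, hK.psiM hm N (by omega), hK.phiM hm N, hdim, hn]
    push_cast
    constructor <;> ring
end mainR
end SupAux

set_option linter.unusedSectionVars false
namespace SupAux
open SupCat SupCat.GSupMod

section semicont
variable {k : Type} [Field k]
variable {U W : Type} [AddCommGroup U] [Module k U] [FiniteDimensional k U]
  [AddCommGroup W] [Module k W] [FiniteDimensional k W]

lemma rkk_semicont (f g : U →ₗ[k] W) :
    ∃ F : Set k, F.Finite ∧ ∀ c ∉ F, rkk f ≤ rkk (f + c • g) := by
  obtain ⟨a, ha⟩ := f.rangeRestrict.exists_rightInverse_of_surjective f.range_rangeRestrict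
  obtain ⟨b, hb⟩ := (LinearMap.range f).subtype.exists_leftInverse_of_injective
    (Submodule.ker_subtype _)
  let T : Module.End k (LinearMap.range f) := b ∘ₗ g ∘ₗ a
  have hfin : (spectrum k T).Finite := Module.End.finite_spectrum T
  refine ⟨(fun c : k => -c⁻¹) '' spectrum k T, hfin.image _, fun c hc => ?_⟩
  have hinj : Function.Injective ((f + c • g) ∘ₗ a) := by
    rw [← LinearMap.ker_eq_bot, eq_bot_iff]
    intro u hu
    have hu : (f + c • g) (a u) = 0 := hu
    have h1 : b (f (a u)) = u := by
      have h2 : f (a u) = ((f.rangeRestrict (a u) : LinearMap.range f) : W) := rfl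
      rw [h2]
      have h3 : f.rangeRestrict (a u) = u := LinearMap.congr_fun ha u
      rw [h3]
      exact LinearMap.congr_fun hb u
    have h2 : u + c • T u = 0 := by
      have := congrArg b hu
      simpa [h1, T] using this
    by_contra hne
    have hne : u ≠ 0 := fun h => hne (by simp [h])
    have hc0 : c ≠ 0 := by
      rintro rfl
      simp at h2
      exact hne h2
    apply hc
    refine ⟨-c⁻¹, ?_, by simp⟩
    apply Module.End.HasEigenvalue.mem_spectrum
    refine Module.End.hasEigenvalue_of_hasEigenvector (x := u) ⟨?_, hne⟩
    rw [Module.End.mem_eigenspace_iff]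
    have h3 : c • T u = -u := eq_neg_of_add_eq_zero_right h2
    have h4 := congrArg (fun w => c⁻¹ • w) h3
    simpa [smul_smul, hc0] using h4
  have h5 : Module.finrank k (LinearMap.range ((f + c • g) ∘ₗ a)) = rkk f :=
    LinearMap.finrank_range_of_inj hinj
  rw [← h5]
  exact Submodule.finrank_mono (LinearMap.range_comp_le_range _ _)

lemma Psi_lin (N : ℕ) (X X' Y : U →ₗ[k] W) (c : k) :
    Psi N (X + c • X') Y = Psi N X Y + c • Psi N X' 0 := by
  refine LinearMap.ext fun t => ?_; funext i; simp [Psi_apply]; abel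

lemma Phi_lin (N : ℕ) (X X' Y : U →ₗ[k] W) (c : k) :
    Phi N (X + c • X') Y = Phi N X Y + c • Phi N X' 0 := by
  refine LinearMap.ext fun t => ?_; funext i; simp [Phi_apply]; abel
end semicont

section constancy
variable {k : Type} [Field k] [CharZero k] {r : ℕ}

/-- validity of a vector -/
def Vld (v : Fin r → k) : Prop := ∃ i : Fin r, (i : ℕ) < r - 1 ∧ v i ≠ 0

/-- the numerical data attached to a vector -/
def Dat (M : GSupMod k (Fin r)) (l v : Fin r → k) (s : ℤ) : Prop :=
  ∀ N : ℕ, Module.finrank k M.carrier ≤ N → 1 ≤ N →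
        4 * (rkk (Psi N (actOf M v) (actOf M l)) : ℤ) =
          (2 * N + 1) * (Module.finrank k M.carrier - 1) - 2 * s ∧
        4 * (rkk (Phi N (actOf M v) (actOf M l)) : ℤ) =
          (2 * N + 1) * (Module.finrank k M.carrier - 1) + 2 * s

lemma actOf_lin (M : GSupMod k (Fin r)) (v d : Fin r → k) (a c : k) :
    actOf M (a • v + c • d) = a • actOf M v + c • actOf M d := by
  simp [actOf, add_smul, mul_smul, Finset.sum_add_distrib, Finset.smul_sum]

lemma onedir (M : GSupMod k (Fin r)) (l v d : Fin r → k) (hv : Vld v) (s : ℤ) (hs : Dat M l v s) :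
    ∃ F : Set k, F.Finite ∧ ∀ c ∉ F, Vld (v + c • d) ∧
      ∀ s', Dat M l (v + c • d) s' → s' = s := by
  obtain ⟨i, hi, hvi⟩ := hv
  let N := Module.finrank k M.carrier + 1
  obtain ⟨F1, f1, h1⟩ := rkk_semicont (Psi N (actOf M v) (actOf M l)) (Psi N (actOf M d) 0)
  obtain ⟨F2, f2, h2⟩ := rkk_semicont (Phi N (actOf M v) (actOf M l)) (Phi N (actOf M d) 0)
  refine ⟨F1 ∪ F2 ∪ {-(v i) / d i}, (f1.union f2).union (Set.finite_singleton _), ?_⟩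
  intro c hc
  simp only [Set.mem_union, Set.mem_singleton_iff, not_or] at hc
  obtain ⟨⟨c1, c2⟩, c3⟩ := hc
  refine ⟨⟨i, hi, ?_⟩, ?_⟩
  · intro h0
    have h0 : v i + c * d i = 0 := h0
    by_cases hd : d i = 0
    · rw [hd, mul_zero, add_zero] at h0
      exact hvi h0
    · apply c3
      rw [eq_div_iff hd]
      linear_combination h0
  · intro s' hs'
    have e : actOf M (v + c • d) = actOf M v + c • actOf M d := by
      have := actOf_lin M v d 1 c
      simpa using this
    have a1 := h1 c c1
    have a2 := h2 c c2
    rw [← Psi_lin, ← e] at a1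
    rw [← Phi_lin, ← e] at a2
    obtain ⟨b1, b2⟩ := hs N (by omega) (by omega)
    obtain ⟨b3, b4⟩ := hs' N (by omega) (by omega)
    omega

lemma const (M : GSupMod k (Fin r)) (l v v' : Fin r → k) (hv : Vld v) (hv' : Vld v')
    (hex : ∀ v, Vld v → ∃ s, Dat M l v s) (s s' : ℤ) (hs : Dat M l v s) (hs' : Dat M l v' s') :
    s = s' := by
  obtain ⟨F, hF, h⟩ := onedir M l v (v' - v) hv s hs
  obtain ⟨F', hF', h'⟩ := onedir M l v' (v - v') hv' s' hs'
  obtain ⟨c, hc⟩ := (hF.union (hF'.image (fun c => 1 - c))).exists_notMem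
  simp only [Set.mem_union, not_or] at hc
  have hc' : 1 - c ∉ F' := fun hh => hc.2 ⟨1 - c, hh, by simp⟩
  have e : v' + (1 - c) • (v - v') = v + c • (v' - v) := by
    funext i; simp; ring
  obtain ⟨w, g⟩ := h c hc.1
  obtain ⟨w', g'⟩ := h' (1 - c) hc'
  obtain ⟨t, ht⟩ := hex _ w
  rw [← g t ht]
  exact g' t (by rw [e]; exact ht)

variable {M : GSupMod k (Fin r)}

lemma core [IsAlgClosed k] (hM : VCat k r M) (hE : IsEndotrivial (VCat k r) M) (l v : Fin r → k)
    (hl : ∀ i : Fin r, (i : ℕ) < r - 1 → l i = 0) (hl0 : l ≠ 0) (hv : Vld v)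
    (q : Bool) (hq : HasPar M.sigma (actOf M l) q)
    (R : GSupMod k (Fin 2)) (e : R.carrier ≃ₗ[k] M.carrier)
    (h0 : ∀ u, e (R.θ 0 u) = actOf M v (e u)) (h1 : ∀ u, e (R.θ 1 u) = actOf M l (e u))
    (hσ : ∀ u, e (R.sigma u) = M.sigma (e u)) :
    ∃ s : ℤ, Dat M l v s ∧
      ∃ K E P : GSupMod k (Fin 2), IsTrivial (not^[s.natAbs] q) K ∧ IsOmega (VCat k 2) s K E ∧
        IsProjective (VCat k 2) P ∧ IsDsum E P R := by
  have hR : VCat k 2 R := by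
    rw [vcat_two_iff]
    refine ⟨?_, ?_, ?_⟩ <;> intro m <;> apply e.injective
    · rw [h0, h0, actOf_sq v hM, map_zero]
    · rw [h1, h1, actOf_sq l hM, map_zero]
    · rw [map_neg, h0, h1, h1, h0]
      exact eq_neg_of_add_eq_zero_left (LinearMap.congr_fun (actOf_comp v l hM) (e m))
  have hc : CH (R.θ 0) (R.θ 1) := by
    intro α β hab
    have hw : α • v + β • l ≠ 0 := by
      obtain ⟨i, hi, hvi⟩ := hv
      intro hw
      have hα : α = 0 := by
        have := congrFun hw i
        simpa [hl i hi, hvi] using this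
      rw [hα, zero_smul, zero_add] at hw
      have := smul_eq_zero.1 hw
      tauto
    have h2 := endotrivial_ch hE _ hw
    rw [← e.finrank_eq] at h2
    rw [← h2]
    congr 1
    rw [actOf_lin]
    refine LinearEquiv.finrank_eq (e.ofSubmodules _ _ ?_)
    ext m
    constructor
    · rintro ⟨u, hu, rfl⟩
      have hu : α • R.θ 0 u + β • R.θ 1 u = 0 := hu
      have := congrArg e hu
      simpa [h0, h1] using this
    · intro hm
      refine ⟨e.symm m, ?_, by simp⟩
      show α • R.θ 0 (e.symm m) + β • R.θ 1 (e.symm m) = 0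
      apply e.injective
      simpa [h0, h1] using hm
  have hqR : HasPar R.sigma (R.θ 1) q := by
    obtain ⟨z, z1, z2, z3⟩ := hq
    refine ⟨e.symm z, ?_, ?_, fun u hu => ?_⟩
    · apply e.injective; rw [hσ, map_smul]; simpa using z1
    · apply e.injective; rw [h1]; simpa using z2
    · apply z3 (e u); rw [← h1, hu]; simp
  obtain ⟨s, hs, hh⟩ := main_R R hR hc q hqR
  refine ⟨s, fun N hN hN1 => ?_, hh⟩
  have := hs N (by rw [e.finrank_eq]; exact hN) hN1
  rwa [psi_conj e h0 h1, phi_conj e h0 h1, e.finrank_eq] at this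

lemma restr_exists (hM : VCat k r M) (l v : Fin r → k) :
    ∃ (R : GSupMod k (Fin 2)) (e : R.carrier ≃ₗ[k] M.carrier),
      (∀ u, e (R.θ 0 u) = actOf M v (e u)) ∧ (∀ u, e (R.θ 1 u) = actOf M l (e u)) ∧
      (∀ u, e (R.sigma u) = M.sigma (e u)) := by
  obtain ⟨Q, e, -, h1, h2, h3⟩ := exists_mod_two M.carrier M.sigma (actOf M v) (actOf M l)
    (sigma_sigma M) (sigma_actOf M v) (sigma_actOf M l) (actOf_sq v hM) (actOf_sq l hM)
    (fun u => eq_neg_of_add_eq_zero_left (LinearMap.congr_fun (actOf_comp v l hM) u))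
  exact ⟨Q, e, h2, h3, h1⟩

lemma restr_data (l v : Fin r → k) (R : GSupMod k (Fin 2)) (h : IsRestriction ![v, l] M R) :
    ∃ e : R.carrier ≃ₗ[k] M.carrier,
      (∀ u, e (R.θ 0 u) = actOf M v (e u)) ∧ (∀ u, e (R.θ 1 u) = actOf M l (e u)) ∧
      (∀ u, e (R.sigma u) = M.sigma (e u)) := by
  obtain ⟨e, h1, h2, h3⟩ := h
  refine ⟨e, h3 0, h3 1, fun u => ?_⟩
  obtain ⟨a, ha, b, hb, rfl⟩ := exists_parts R u
  rw [map_add, map_add, map_add, map_add, sigma_of_ev R ha, sigma_of_od R hb,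
    sigma_of_ev M ((h1 a).1 ha), sigma_of_od M ((h2 b).1 hb), map_neg]

lemma par_exists (hM : VCat k r M) (hE : IsEndotrivial (VCat k r) M) (l : Fin r → k) (hl0 : l ≠ 0) :
    ∃ q, HasPar M.sigma (actOf M l) q := by
  have h1 := endotrivial_ch hE l hl0
  have h2 := LinearMap.finrank_range_add_finrank_ker (actOf M l)
  obtain ⟨z, hz, hzr⟩ : ∃ z, actOf M l z = 0 ∧ z ∉ LinearMap.range (actOf M l) := by
    by_contra hcon
    push Not at hcon
    have h3 := Submodule.finrank_mono (s := LinearMap.ker (actOf M l))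
      (t := LinearMap.range (actOf M l)) (fun z hz => hcon z hz)
    omega
  obtain ⟨a, ha, b, hb, rfl⟩ := exists_parts M z
  have hs := sigma_actOf M l (a + b)
  rw [hz, map_zero, map_add, sigma_of_ev M ha, sigma_of_od M hb, map_add, map_neg] at hs
  rw [map_add] at hz
  have hab : actOf M l a = actOf M l b := by
    have := eq_neg_of_add_eq_zero_left (neg_eq_zero.1 hs.symm)
    rwa [neg_neg] at this
  have ha0 : actOf M l a = 0 := by
    apply self_eq_neg_zero (k := k)
    rw [← hab] at hz
    exact eq_neg_of_add_eq_zero_left hz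
  have hb0 : actOf M l b = 0 := by rw [← hab, ha0]
  by_cases har : a ∈ LinearMap.range (actOf M l)
  · have hbr : b ∉ LinearMap.range (actOf M l) := fun hbr => hzr (add_mem har hbr)
    exact ⟨true, b, by rw [sigma_of_od M hb]; simp [sg], hb0, fun u hu => hbr ⟨u, hu⟩⟩
  · exact ⟨false, a, by rw [sigma_of_ev M ha]; simp [sg], ha0, fun u hu => har ⟨u, hu⟩⟩
end constancy
end SupAux

open SupCat SupCat.GSupMod in
/-- Let `M` be an endotrivial `V(a_r)`-supermodule, where
`a_r` is a rank `r` detecting subalgebra with odd basis `{a_1, …, a_r}`.  Let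
`v = c_1 a_1 + ⋯ + c_r a_r ∈ (a_r)₁` with `c_i ≠ 0` for some `i < r`, and let
`A = ⟨v, a_r⟩` be the `4`-dimensional subsuperalgebra of `V(a_r)` generated by
`v` and `a_r` (so `A ≅ V(a₂)`).  Then there exist an integer `s` and a parity,
both independent of the choice of `v`, such that
`M|_A ≅ Ω^s(k|_A) ⊕ P` for some projective `A`-module `P`, where `k|_A` is
either `k_ev` or `k_od`. -/
theorem restriction_of_endotrivial_to_rank_two
    (k : Type) [Field k] [IsAlgClosed k] [CharZero k]
    (r : ℕ) (hr : 2 ≤ r)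
    (M : GSupMod k (Fin r)) (hM : VCat k r M)
    (hE : IsEndotrivial (VCat k r) M) :
    ∃ (s : ℤ) (p : Bool),
      ∀ v : Fin r → k, (∃ i : Fin r, (i : ℕ) < r - 1 ∧ v i ≠ 0) →
        ∀ R : GSupMod k (Fin 2),
          IsRestriction ![v, Pi.single (⟨r - 1, by omega⟩ : Fin r) 1] M R →
          ∃ K N P : GSupMod k (Fin 2),
            IsTrivial p K ∧ IsOmega (VCat k 2) s K N ∧
            IsProjective (VCat k 2) P ∧ IsDsum N P R := by
  let l : Fin r → k := Pi.single (⟨r - 1, by omega⟩ : Fin r) 1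
  have hl : ∀ i : Fin r, (i : ℕ) < r - 1 → l i = 0 := by
    intro i hi
    refine Pi.single_eq_of_ne ?_ _
    intro h
    rw [h] at hi
    simp at hi
  have hl0 : l ≠ 0 := by
    intro h
    have := congrFun h ⟨r - 1, by omega⟩
    simp [l] at this
  obtain ⟨q, hq⟩ := SupAux.par_exists hM hE l hl0
  have hex : ∀ v, SupAux.Vld v → ∃ s, SupAux.Dat M l v s := by
    intro v hv
    obtain ⟨R, e, h0, h1, h2⟩ := SupAux.restr_exists hM l v
    obtain ⟨s, hs, -⟩ := SupAux.core hM hE l v hl hl0 hv q hq R e h0 h1 h2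
    exact ⟨s, hs⟩
  let v₀ : Fin r → k := fun _ => 1
  have hv₀ : SupAux.Vld v₀ := ⟨⟨0, by omega⟩, by simp only; omega, one_ne_zero⟩
  obtain ⟨s, hs⟩ := hex v₀ hv₀
  refine ⟨s, not^[s.natAbs] q, fun v hv R hR => ?_⟩
  obtain ⟨e, h0, h1, h2⟩ := SupAux.restr_data l v R hR
  obtain ⟨t, ht, hh⟩ := SupAux.core hM hE l v hl hl0 hv q hq R e h0 h1 h2
  have hst : s = t := SupAux.const M l v₀ v hv₀ hv hex s t hs ht
  rw [hst]
  exact hh
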